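/- arXiv:1908.10795 — 3 statements merged into one kernel-verified Lean document; each statement's English description precedes it below -/
import Mathlib

section
/- Let D be a digraph and c, k positive integers. Then the arc set of D can be partitioned into k branchings each of which has at least c roots (k pairwise arc-disjoint c⁺-branchings whose union is D) if and only if the maximum in-degree Δ⁻(D) is at most k, the fractional arboricity Υ₁(D) is at most k, and |E(D)| ≤ k(|V(D)| − c). -/
open Finset

section BranchSetup

variable {V A : Type} [Fintype V] [DecidableEq V] [Fintype A] [DecidableEq A]

/-- One arc-step within the arc set `B` of the digraph `D = (V, A)`. -/
def DStep (tl hd : A → V) (B : Finset A) (u v : V) : Prop :=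
  ∃ a ∈ B, tl a = u ∧ hd a = v

/-- `B` is a branching: every vertex has in-degree at most one in `B` and `B`
contains no (directed) cycle; equivalently each component of the spanning
subdigraph `(V, B)` is an arborescence. -/
def IsBranching (tl hd : A → V) (B : Finset A) : Prop :=
  (∀ a ∈ B, ∀ b ∈ B, hd a = hd b → a = b) ∧
  (∀ v : V, ¬ Relation.TransGen (DStep tl hd B) v v)

/-- The root set `R(B)` of a branching: the vertices of in-degree zero, i.e.
the roots of the arborescence components. -/
def roots (hd : A → V) (B : Finset A) : Finset V :=
  Finset.univ.filter fun v => ∀ a ∈ B, hd a ≠ v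

/-- `d⁻_{A₀}(X)`: the number of arcs of `A₀` with head in `X` and tail
outside of `X`. -/
def dInD (tl hd : A → V) (A₀ : Finset A) (X : Finset V) : ℕ :=
  (A₀.filter fun a => hd a ∈ X ∧ tl a ∉ X).card

end BranchSetup

theorem dInD_inter_add_union_le {V A : Type} [DecidableEq V]
    (tl hd : A → V) (A₀ : Finset A) (X Y : Finset V) :
    dInD tl hd A₀ (X ∩ Y) + dInD tl hd A₀ (X ∪ Y) ≤ dInD tl hd A₀ X + dInD tl hd A₀ Y := by
  simp only [dInD, card_filter, ← sum_add_distrib]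
  refine sum_le_sum fun a _ => ?_
  by_cases h1 : hd a ∈ X <;> by_cases h2 : hd a ∈ Y <;> by_cases h3 : tl a ∈ X <;>
    by_cases h4 : tl a ∈ Y <;> simp [h1, h2, h3, h4]

theorem card_disjoint_add_le {V ι : Type} [DecidableEq V] [Fintype ι]
    (R : ι → Finset V) (X Y : Finset V) :
    (univ.filter fun i => Disjoint (R i) X).card + (univ.filter fun i => Disjoint (R i) Y).card ≤
      (univ.filter fun i => Disjoint (R i) (X ∩ Y)).card +
        (univ.filter fun i => Disjoint (R i) (X ∪ Y)).card := by
  simp only [card_filter, ← sum_add_distrib]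
  refine sum_le_sum fun i _ => ?_
  have h_left : Disjoint (R i) X → Disjoint (R i) (X ∩ Y) := .mono_right inter_subset_left
  have h_right : Disjoint (R i) Y → Disjoint (R i) (X ∩ Y) := .mono_right inter_subset_right
  by_cases h1 : Disjoint (R i) X <;> by_cases h2 : Disjoint (R i) Y <;>
    simp [h1, h2, h_left, h_right, disjoint_union_right]

theorem card_disjoint_add_lt {V ι : Type} [DecidableEq V] [Fintype ι]
    (R : ι → Finset V) (X Y : Finset V) (j : ι) (hX : ¬ Disjoint (R j) X)
    (hY : ¬ Disjoint (R j) Y) (hXY : Disjoint (R j) (X ∩ Y)) :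
    (univ.filter fun i => Disjoint (R i) X).card + (univ.filter fun i => Disjoint (R i) Y).card <
      (univ.filter fun i => Disjoint (R i) (X ∩ Y)).card +
        (univ.filter fun i => Disjoint (R i) (X ∪ Y)).card := by
  simp only [card_filter, ← sum_add_distrib]
  refine sum_lt_sum (fun i _ => ?_) ⟨j, mem_univ j, by simp [hX, hY, hXY]⟩
  have h_left : Disjoint (R i) X → Disjoint (R i) (X ∩ Y) := .mono_right inter_subset_left
  have h_right : Disjoint (R i) Y → Disjoint (R i) (X ∩ Y) := .mono_right inter_subset_right
  by_cases h1 : Disjoint (R i) X <;> by_cases h2 : Disjoint (R i) Y <;>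
    simp [h1, h2, h_left, h_right, disjoint_union_right]

theorem not_transGen_dStep_of_forall_ne {V A : Type} {tl hd : A → V} {B : Finset A} {u : V}
    (hu : ∀ a ∈ B, hd a ≠ u) (x : V) : ¬ Relation.TransGen (DStep tl hd B) x u := by
  intro h
  obtain ⟨y, -, a, ha, -, hau⟩ := Relation.TransGen.tail'_iff.1 h
  exact hu a ha hau

section

variable {V A : Type} [Fintype V] [DecidableEq V] [Fintype A] [DecidableEq A]

theorem mem_roots {hd : A → V} {B : Finset A} {v : V} :
    v ∈ roots hd B ↔ ∀ a ∈ B, hd a ≠ v := by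
  simp [roots]

theorem card_roots_add_card {tl hd : A → V} {B : Finset A} (hB : IsBranching tl hd B) :
    (roots hd B).card + B.card = Fintype.card V := by
  have h : roots hd B = (B.image hd)ᶜ := by
    ext v
    simp [mem_roots]
  rw [h, ← card_image_of_injOn (s := B) (f := hd) fun a ha b hb hab => hB.1 a ha b hb hab,
    card_compl_add_card]

omit [Fintype V] [DecidableEq V] [Fintype A] [DecidableEq A] in
theorem isBranching_empty (tl hd : A → V) : IsBranching tl hd ∅ := by
  refine ⟨by simp, fun v => not_transGen_dStep_of_forall_ne (by simp) v⟩

theorem IsBranching.insert {tl hd : A → V} {B : Finset A} (hB : IsBranching tl hd B) {a : A}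
    (hh : hd a ∈ roots hd B) (ht : tl a ∈ roots hd B) (hne : tl a ≠ hd a) :
    IsBranching tl hd (insert a B) := by
  rw [mem_roots] at hh ht
  refine ⟨?_, fun x hx => ?_⟩
  · intro b hb b' hb' hbb
    rw [mem_insert] at hb hb'
    rcases hb with rfl | hb <;> rcases hb' with rfl | hb'
    · rfl
    · exact (hh _ hb' hbb.symm).elim
    · exact (hh _ hb hbb).elim
    · exact hB.1 _ hb _ hb' hbb
  · have key : ∀ y, Relation.TransGen (DStep tl hd (Insert.insert a B)) x y →
        x = tl a ∨ Relation.TransGen (DStep tl hd B) x y := by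
      intro y hy
      induction hy with
      | single h =>
        obtain ⟨b, hb, rfl, rfl⟩ := h
        rcases mem_insert.1 hb with rfl | hb
        · exact Or.inl rfl
        · exact Or.inr (.single ⟨b, hb, rfl, rfl⟩)
      | tail _ h ih =>
        rcases ih with ih | ih
        · exact Or.inl ih
        obtain ⟨b, hb, rfl, rfl⟩ := h
        rcases mem_insert.1 hb with rfl | hb
        · exact (not_transGen_dStep_of_forall_ne ht _ ih).elim
        · exact Or.inr (ih.tail ⟨b, hb, rfl, rfl⟩)
    rcases key x hx with rfl | h
    · refine not_transGen_dStep_of_forall_ne (fun b hb => ?_) _ hx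
      rcases mem_insert.1 hb with rfl | hb
      · exact hne.symm
      · exact ht b hb
    · exact hB.2 x h

theorem roots_insert (hd : A → V) (B : Finset A) (a : A) :
    roots hd (insert a B) = (roots hd B).erase (hd a) := by
  ext v
  simp only [mem_roots, mem_erase, forall_mem_insert]
  exact and_congr_left' ne_comm

omit [DecidableEq V] [Fintype A] [DecidableEq A] in
/-- A branching has, in every nonempty vertex set, a vertex that no arc enters from inside. -/
theorem IsBranching.exists_forall_tl_notMem {tl hd : A → V} {B : Finset A}
    (hB : IsBranching tl hd B) {X : Finset V} (hX : X.Nonempty) :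
    ∃ v ∈ X, ∀ a ∈ B, hd a = v → tl a ∉ X := by
  have : IsTrans V (Relation.TransGen (DStep tl hd B)) := ⟨fun _ _ _ => Relation.TransGen.trans⟩
  have : Std.Irrefl (Relation.TransGen (DStep tl hd B)) := ⟨hB.2⟩
  obtain ⟨v, hv, hmin⟩ :=
    (Finite.wellFounded_of_trans_of_irrefl (Relation.TransGen (DStep tl hd B))).has_min
      (X : Set V) hX
  exact ⟨v, hv, fun a ha hav hta => hmin _ hta (.single ⟨a, ha, rfl, hav⟩)⟩

theorem IsBranching.exists_entering {tl hd : A → V} {B : Finset A}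
    (hB : IsBranching tl hd B) {X : Finset V} (hX : X.Nonempty)
    (hdisj : Disjoint (roots hd B) X) : ∃ a ∈ B, hd a ∈ X ∧ tl a ∉ X := by
  obtain ⟨v, hv, h⟩ := hB.exists_forall_tl_notMem hX
  have hr : v ∉ roots hd B := fun hr => disjoint_left.1 hdisj hr hv
  rw [mem_roots] at hr
  push Not at hr
  obtain ⟨a, ha, rfl⟩ := hr
  exact ⟨a, ha, hv, h a ha rfl⟩

omit [Fintype A] [DecidableEq A] in
theorem IsBranching.card_induced_le {tl hd : A → V} {B : Finset A}
    (hB : IsBranching tl hd B) {X : Finset V} (hX : X.Nonempty) :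
    (B.filter fun a => tl a ∈ X ∧ hd a ∈ X).card ≤ X.card - 1 := by
  obtain ⟨v, hv, h⟩ := hB.exists_forall_tl_notMem hX
  rw [← card_erase_of_mem hv]
  refine card_le_card_of_injOn hd (fun a ha => ?_) fun a ha b hb hab => ?_
  · simp only [coe_filter, Set.mem_ofPred_eq] at ha
    exact mem_coe.2 (mem_erase.2 ⟨fun e => h a ha.1 e ha.2.1, ha.2.2⟩)
  · exact hB.1 a (mem_filter.1 ha).1 b (mem_filter.1 hb).1 hab

/-- **Edmonds' disjoint branchings theorem.** -/
theorem exists_disjoint_branchings {ι : Type} [Fintype ι] [DecidableEq ι] (tl hd : A → V)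
    (A₀ : Finset A) (R : ι → Finset V)
    (h : ∀ X : Finset V, X.Nonempty →
      (univ.filter fun i => Disjoint (R i) X).card ≤ dInD tl hd A₀ X) :
    ∃ B : ι → Finset A, (∀ i, B i ⊆ A₀) ∧ (∀ i, IsBranching tl hd (B i)) ∧
      (∀ i j, i ≠ j → Disjoint (B i) (B j)) ∧ ∀ i, roots hd (B i) = R i := by
  induction A₀ using Finset.strongInduction generalizing R with
  | H A₀ ih =>
  by_cases hR : ∀ i, R i = univ
  · refine ⟨fun _ => ∅, by simp, fun _ => isBranching_empty tl hd, by simp, fun i => ?_⟩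
    rw [hR i]
    ext
    simp [mem_roots]
  push Not at hR
  obtain ⟨j, hj⟩ := hR
  obtain ⟨x, hx⟩ : ∃ x, x ∉ R j := by
    by_contra! hall
    exact hj (eq_univ_iff_forall.2 hall)
  have htight : (univ.filter fun i => Disjoint (R i) univ).card = dInD tl hd A₀ univ := by
    have h1 := h univ ⟨x, mem_univ x⟩
    have h2 : dInD tl hd A₀ univ = 0 := by simp [dInD]
    omega
  have hjne : ¬ Disjoint (R j) univ := by
    intro hdis
    have h2 : dInD tl hd A₀ univ = 0 := by simp [dInD]
    rw [h2, card_eq_zero] at htight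
    exact notMem_empty j (htight ▸ mem_filter.2 ⟨mem_univ j, hdis⟩)
  let P : Finset V → Prop := fun W => ¬ Disjoint (R j) W ∧ (∃ y ∈ W, y ∉ R j) ∧
    (univ.filter fun i => Disjoint (R i) W).card = dInD tl hd A₀ W
  obtain ⟨W, ⟨hW1, ⟨y, hyW, hyR⟩, hW3⟩, hmin⟩ :
      ∃ W, P W ∧ ∀ W', W' ⊂ W → ¬ P W' := by
    obtain ⟨W, hW, hm⟩ := (wellFounded_lt (α := Finset V)).has_min {W | P W}
      ⟨univ, hjne, ⟨x, mem_univ x, hx⟩, htight⟩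
    exact ⟨W, hW, fun W' hlt hP => hm W' hP hlt⟩
  have hlt : dInD tl hd A₀ W < dInD tl hd A₀ (W \ R j) := by
    rw [← hW3]
    refine lt_of_lt_of_le (card_lt_card ?_) (h (W \ R j) ⟨y, mem_sdiff.2 ⟨hyW, hyR⟩⟩)
    refine (ssubset_iff_of_subset fun i hi => ?_).2 ⟨j, ?_, ?_⟩
    · exact mem_filter.2 ⟨mem_univ i, (mem_filter.1 hi).2.mono_right sdiff_subset⟩
    · exact mem_filter.2 ⟨mem_univ j, disjoint_sdiff⟩
    · exact fun hj' => hW1 (mem_filter.1 hj').2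
  obtain ⟨a, ha, haW⟩ := exists_mem_notMem_of_card_lt_card hlt
  simp only [mem_filter, mem_sdiff, not_and, not_not] at ha haW
  obtain ⟨haA, ⟨hvW, hvR⟩, hu⟩ := ha
  have huW : tl a ∈ W := haW haA hvW
  have huR : tl a ∈ R j := hu huW
  have hne : tl a ≠ hd a := fun e => hvR (e ▸ huR)
  obtain ⟨B, hB1, hB2, hB3, hB4⟩ := ih (A₀.erase a) (erase_ssubset haA)
    (Function.update R j (insert (hd a) (R j))) (by
      intro X hX
      have hRX := h X hX
      have hsub : (univ.filter fun i =>
          Disjoint (Function.update R j (insert (hd a) (R j)) i) X) ⊆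
          univ.filter fun i => Disjoint (R i) X := by
        intro i hi
        rw [mem_filter] at hi ⊢
        refine ⟨hi.1, hi.2.mono_left ?_⟩
        by_cases hij : i = j
        · subst hij
          simp
        · simp [hij]
      have hle := card_le_card hsub
      have hfe : (A₀.erase a).filter (fun a => hd a ∈ X ∧ tl a ∉ X) =
          (A₀.filter fun a => hd a ∈ X ∧ tl a ∉ X).erase a := filter_erase ..
      by_cases hent : hd a ∈ X ∧ tl a ∉ X
      · have hd1 : dInD tl hd (A₀.erase a) X = dInD tl hd A₀ X - 1 := by
          unfold dInD
          rw [hfe, card_erase_of_mem (mem_filter.2 ⟨haA, hent⟩)]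
        rw [hd1]
        by_cases hdj : Disjoint (R j) X
        · have hss := card_lt_card ((ssubset_iff_of_subset hsub).2
            ⟨j, mem_filter.2 ⟨mem_univ j, hdj⟩, by simp [hent.1]⟩)
          omega
        · by_contra hcon
          have hXt : (univ.filter fun i => Disjoint (R i) X).card = dInD tl hd A₀ X := by omega
          have hvXW : hd a ∈ X ∩ W := mem_inter.2 ⟨hent.1, hvW⟩
          have h1 := h (X ∩ W) ⟨_, hvXW⟩
          have h2 := h (X ∪ W) (hX.mono subset_union_left)
          have h3 := dInD_inter_add_union_le tl hd A₀ X W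
          by_cases hXW : Disjoint (R j) (X ∩ W)
          · have h4 := card_disjoint_add_lt R X W j hdj hW1 hXW
            omega
          · have h4 := card_disjoint_add_le R X W
            refine hmin (X ∩ W) ((ssubset_iff_of_subset inter_subset_right).2
              ⟨tl a, huW, fun hm => hent.2 (mem_inter.1 hm).1⟩) ⟨hXW, ⟨_, hvXW, hvR⟩, ?_⟩
            omega
      · have hd1 : dInD tl hd (A₀.erase a) X = dInD tl hd A₀ X := by
          unfold dInD
          have ha_mem : a ∉ A₀.filter fun a => hd a ∈ X ∧ tl a ∉ X :=
            fun hm => hent (mem_filter.1 hm).2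
          rw [hfe, erase_eq_of_notMem ha_mem]
        omega)
  have hBj : roots hd (B j) = insert (hd a) (R j) := by simpa using hB4 j
  have haB : ∀ i, a ∉ B i := fun i hi => notMem_erase a A₀ (hB1 i hi)
  refine ⟨Function.update B j (insert a (B j)), fun i => ?_, fun i => ?_, fun i l hil => ?_,
    fun i => ?_⟩
  · by_cases hij : i = j
    · subst hij
      simpa using insert_subset haA ((hB1 i).trans (erase_subset a A₀))
    · simpa [hij] using (hB1 i).trans (erase_subset a A₀)
  · by_cases hij : i = j
    · subst hij
      simpa using (hB2 i).insert (by simp [hBj]) (by simp [hBj, huR]) hne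
    · simpa [hij] using hB2 i
  · by_cases hij : i = j <;> by_cases hlj : l = j
    · exact (hil (hij.trans hlj.symm)).elim
    · subst hij
      simpa [hlj, haB] using hB3 i l hil
    · subst hlj
      simpa [hij, haB] using hB3 i l hil
    · simpa [hij, hlj] using hB3 i l hil
  · by_cases hij : i = j
    · subst hij
      simp [roots_insert, hBj, erase_insert hvR]
    · simpa [hij] using hB4 i

/-- Two disjoint branchings can be rearranged so that one root moves from the larger root set to
the smaller one. -/
theorem exists_exchange {tl hd : A → V} {B C : Finset A} (hB : IsBranching tl hd B)
    (hC : IsBranching tl hd C) (hBC : Disjoint B C)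
    (hlt : (roots hd C).card < (roots hd B).card) :
    ∃ B' C' : Finset A, IsBranching tl hd B' ∧ IsBranching tl hd C' ∧ Disjoint B' C' ∧
      B' ∪ C' = B ∪ C ∧ (roots hd B').card + 1 = (roots hd B).card ∧
      (roots hd C').card = (roots hd C).card + 1 := by
  obtain ⟨v, hvB, hvC, hv⟩ : ∃ v ∈ roots hd B, v ∉ roots hd C ∧ ∀ X : Finset V, v ∈ X →
      dInD tl hd (B ∪ C) X = 0 → ∃ w ∈ roots hd B, w ∈ X ∧ w ≠ v := by
    by_contra! hcon
    have hclosed : ∀ X : Finset V, dInD tl hd (B ∪ C) X = 0 →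
        ∀ a ∈ B ∪ C, hd a ∈ X → tl a ∈ X := by
      intro X hX a ha haX
      by_contra hta
      exact notMem_empty a (card_eq_zero.1 hX ▸ mem_filter.2 ⟨ha, haX, hta⟩)
    choose! X hX1 hX2 hX3 using hcon
    have hw : ∀ v ∈ roots hd B \ roots hd C, ∃ w ∈ roots hd C, w ∈ X v := by
      intro v hv
      rw [mem_sdiff] at hv
      by_contra! hno
      obtain ⟨a, ha, hhd, htl⟩ := hC.exists_entering ⟨v, hX1 v hv.1 hv.2⟩
        (disjoint_left.2 hno)
      exact htl (hclosed _ (hX2 v hv.1 hv.2) a (mem_union_right _ ha) hhd)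
    choose! w hwC hwX using hw
    have hle : (roots hd B \ roots hd C).card ≤ (roots hd C \ roots hd B).card := by
      refine card_le_card_of_injOn w (fun v hv => ?_) fun v hv v' hv' hvv => ?_
      · have hv2 := mem_sdiff.1 (mem_coe.1 hv)
        refine mem_coe.2 (mem_sdiff.2 ⟨hwC v hv, fun hwB => hv2.2 ?_⟩)
        rw [← hX3 v hv2.1 hv2.2 _ hwB (hwX v hv)]
        exact hwC v hv
      · have hv2 := mem_sdiff.1 (mem_coe.1 hv)
        have hv2' := mem_sdiff.1 (mem_coe.1 hv')
        by_contra hne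
        obtain ⟨a, ha, hhd, htl⟩ := hB.exists_entering (X := X v ∩ X v')
          ⟨w v, mem_inter.2 ⟨hwX v hv, hvv ▸ hwX v' hv'⟩⟩ (disjoint_left.2 fun r hr hrX => by
            rw [mem_inter] at hrX
            exact hne ((hX3 v hv2.1 hv2.2 r hr hrX.1).symm.trans
              (hX3 v' hv2'.1 hv2'.2 r hr hrX.2)))
        rw [mem_inter] at hhd
        exact htl (mem_inter.2
          ⟨hclosed _ (hX2 v hv2.1 hv2.2) a (mem_union_left _ ha) hhd.1,
            hclosed _ (hX2 v' hv2'.1 hv2'.2) a (mem_union_left _ ha) hhd.2⟩)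
    have := card_sdiff_add_card_inter (roots hd B) (roots hd C)
    have := card_sdiff_add_card_inter (roots hd C) (roots hd B)
    rw [inter_comm] at this
    omega
  obtain ⟨T, hT1, hT2, hT3, hT4⟩ := exists_disjoint_branchings tl hd (B ∪ C)
    (fun b : Bool => if b then (roots hd B).erase v else insert v (roots hd C)) (by
      intro X hX
      have hfil : (univ.filter fun b : Bool => Disjoint
          (if b then (roots hd B).erase v else insert v (roots hd C)) X).card =
          (if Disjoint ((roots hd B).erase v) X then 1 else 0) +
          (if Disjoint (insert v (roots hd C)) X then 1 else 0) := by
        rw [card_filter, Fintype.sum_bool]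
        rfl
      rw [hfil]
      have hCX : Disjoint (insert v (roots hd C)) X → ∃ a ∈ C, hd a ∈ X ∧ tl a ∉ X :=
        fun hdis => hC.exists_entering hX (hdis.mono_left (subset_insert _ _))
      have hBX : Disjoint (roots hd B) X → ∃ a ∈ B, hd a ∈ X ∧ tl a ∉ X :=
        hB.exists_entering hX
      by_cases hvX : v ∈ X
      · have hCd : ¬ Disjoint (insert v (roots hd C)) X := by simp [hvX]
        simp only [hCd, if_false, add_zero]
        split_ifs with hBd
        · rw [Nat.one_le_iff_ne_zero]
          intro h0
          obtain ⟨w, hw, hwX, hwv⟩ := hv X hvX h0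
          exact disjoint_left.1 hBd (mem_erase.2 ⟨hwv, hw⟩) hwX
        · exact Nat.zero_le _
      · have hsplit : dInD tl hd (B ∪ C) X = dInD tl hd B X + dInD tl hd C X := by
          unfold dInD
          rw [filter_union, card_union_of_disjoint (disjoint_filter_filter hBC)]
        rw [hsplit]
        refine Nat.add_le_add ?_ ?_
        · split_ifs with hBd
          · have hBd' : Disjoint (roots hd B) X := disjoint_left.2 fun r hr hrX =>
              disjoint_left.1 hBd (mem_erase.2 ⟨fun e => hvX (e ▸ hrX), hr⟩) hrX
            obtain ⟨a, ha, haX⟩ := hBX hBd'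
            exact card_pos.2 ⟨a, mem_filter.2 ⟨ha, haX⟩⟩
          · exact Nat.zero_le _
        · split_ifs with hCd
          · obtain ⟨a, ha, haX⟩ := hCX hCd
            exact card_pos.2 ⟨a, mem_filter.2 ⟨ha, haX⟩⟩
          · exact Nat.zero_le _)
  have hdis : Disjoint (T true) (T false) := hT3 _ _ (by simp)
  have hrB : (roots hd (T true)).card + 1 = (roots hd B).card := by
    rw [hT4 true, if_pos rfl, card_erase_add_one hvB]
  have hrC : (roots hd (T false)).card = (roots hd C).card + 1 := by
    rw [hT4 false, if_neg (by simp), card_insert_of_notMem hvC]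
  refine ⟨T true, T false, hT2 _, hT2 _, hdis, ?_, hrB, hrC⟩
  refine eq_of_subset_of_card_le (union_subset (hT1 _) (hT1 _)) ?_
  rw [card_union_of_disjoint hdis, card_union_of_disjoint hBC]
  have h1 := card_roots_add_card hB
  have h2 := card_roots_add_card hC
  have h3 := card_roots_add_card (hT2 true)
  have h4 := card_roots_add_card (hT2 false)
  omega

/-- A decomposition of the arc set into branchings. -/
def IsBranchingDecomposition {ι : Type} [Fintype ι] (tl hd : A → V) (B : ι → Finset A) : Prop :=
  (∀ i, IsBranching tl hd (B i)) ∧ (∀ i j, i ≠ j → Disjoint (B i) (B j)) ∧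
    univ.biUnion B = (univ : Finset A)

omit [Fintype V] [DecidableEq V] in
theorem IsBranchingDecomposition.sum_card_filter {ι : Type} [Fintype ι] {tl hd : A → V}
    {B : ι → Finset A} (hB : IsBranchingDecomposition tl hd B) (p : A → Prop)
    [DecidablePred p] : ∑ i, ((B i).filter p).card = (univ.filter p).card := by
  rw [← hB.2.2, filter_biUnion, card_biUnion]
  exact fun i _ j _ hij => disjoint_filter_filter (hB.2.1 i j hij)

omit [Fintype V] [DecidableEq V] in
theorem IsBranchingDecomposition.sum_card {ι : Type} [Fintype ι] {tl hd : A → V}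
    {B : ι → Finset A} (hB : IsBranchingDecomposition tl hd B) :
    ∑ i, (B i).card = Fintype.card A := by
  simpa using hB.sum_card_filter fun _ => True

theorem IsBranchingDecomposition.sum_card_roots_add {ι : Type} [Fintype ι] {tl hd : A → V}
    {B : ι → Finset A} (hB : IsBranchingDecomposition tl hd B) :
    ∑ i, (roots hd (B i)).card + Fintype.card A = Fintype.card ι * Fintype.card V := by
  rw [← hB.sum_card, ← sum_add_distrib, sum_congr rfl fun i _ => card_roots_add_card (hB.1 i)]
  simp

/-- A decomposition into branchings exists if the in-degrees and the fractional arboricity are at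
most the number of branchings. -/
theorem exists_isBranchingDecomposition {ι : Type} [Fintype ι] [DecidableEq ι] (tl hd : A → V)
    (hdeg : ∀ v : V, (univ.filter fun a : A => hd a = v).card ≤ Fintype.card ι)
    (harb : ∀ X : Finset V, X.Nonempty →
      (univ.filter fun a : A => tl a ∈ X ∧ hd a ∈ X).card ≤ Fintype.card ι * (X.card - 1)) :
    ∃ B : ι → Finset A, IsBranchingDecomposition tl hd B := by
  let d : V → ℕ := fun v => (univ.filter fun a : A => hd a = v).card
  let S := Σ v : V, Fin (Fintype.card ι - d v)
  let tl' : A ⊕ S → Option V := Sum.elim (fun a => some (tl a)) fun _ => none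
  let hd' : A ⊕ S → Option V := Sum.elim (fun a => some (hd a)) fun s => some s.1
  have hsumd : ∀ Y : Finset V, ∑ v ∈ Y, d v = (univ.filter fun a : A => hd a ∈ Y).card := by
    intro Y
    rw [card_eq_sum_card_fiberwise (f := hd) (t := Y) (fun a ha => by simpa using ha)]
    refine sum_congr rfl fun v hv => congrArg card ?_
    ext a
    simp only [mem_filter, mem_univ, true_and]
    exact ⟨fun e => ⟨e ▸ hv, e⟩, fun e => e.2⟩
  have hsumS : ∀ Y : Finset V,
      (univ.filter fun s : S => s.1 ∈ Y).card + ∑ v ∈ Y, d v = Fintype.card ι * Y.card := by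
    intro Y
    have : (univ.filter fun s : S => s.1 ∈ Y) = Y.sigma fun _ => univ := by
      ext s
      exact ⟨fun h => mem_sigma.2 ⟨(mem_filter.1 h).2, mem_univ _⟩,
        fun h => mem_filter.2 ⟨mem_univ _, (mem_sigma.1 h).1⟩⟩
    rw [this, card_sigma, ← sum_add_distrib, mul_comm, ← smul_eq_mul]
    refine sum_eq_card_nsmul fun v _ => ?_
    simpa using Nat.sub_add_cancel (hdeg v)
  obtain ⟨T, -, hT2, hT3, hT4⟩ := exists_disjoint_branchings tl' hd' univ
    (fun _ : ι => {none}) (by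
      intro X hX
      by_cases hn : none ∈ X
      · simp [hn]
      · let Y : Finset V := univ.filter fun v => some v ∈ X
        have hY : Y.Nonempty := by
          obtain ⟨o, ho⟩ := hX
          cases o with
          | none => exact (hn ho).elim
          | some v => exact ⟨v, by simpa [Y] using ho⟩
        have hmem : ∀ v, some v ∈ X ↔ v ∈ Y := by simp [Y]
        have hdin : dInD tl' hd' univ X =
            (univ.filter fun a : A => hd a ∈ Y ∧ tl a ∉ Y).card +
              (univ.filter fun s : S => s.1 ∈ Y).card := by
          simp only [dInD, card_filter, Fintype.sum_sum_type]
          simp [tl', hd', hmem, hn]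
        have hspl : (univ.filter fun a : A => hd a ∈ Y ∧ tl a ∉ Y).card +
            (univ.filter fun a : A => tl a ∈ Y ∧ hd a ∈ Y).card =
            (univ.filter fun a : A => hd a ∈ Y).card := by
          simp only [card_filter, ← sum_add_distrib]
          refine sum_congr rfl fun a _ => ?_
          by_cases h1 : hd a ∈ Y <;> by_cases h2 : tl a ∈ Y <;> simp [h1, h2]
        have h1 := hsumd Y
        have h2 := hsumS Y
        have h3 := harb Y hY
        have h4 : Fintype.card ι * Y.card =
            Fintype.card ι * (Y.card - 1) + Fintype.card ι := by
          rw [← Nat.mul_succ, Nat.succ_eq_add_one, Nat.sub_add_cancel hY.card_pos]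
        have h5 := card_le_univ (univ.filter fun _ : ι => Disjoint ({none} : Finset (Option V)) X)
        omega)
  have hcover : univ.biUnion T = univ := by
    refine eq_univ_of_card _ ?_
    rw [card_biUnion fun i _ j _ hij => hT3 i j hij]
    have hcT : ∀ i, (T i).card = Fintype.card V := by
      intro i
      have h1 := card_roots_add_card (hT2 i)
      rw [hT4 i, card_singleton, Fintype.card_option] at h1
      omega
    have h1 := hsumd univ
    have h2 := hsumS univ
    simp only [mem_univ, filter_true, card_univ] at h1 h2
    rw [sum_congr rfl fun i _ => hcT i, Fintype.card_sum, sum_const, card_univ, smul_eq_mul]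
    omega
  refine ⟨fun i => univ.filter fun a => Sum.inl a ∈ T i, fun i => ⟨?_, ?_⟩, fun i j hij => ?_, ?_⟩
  · intro a ha b hb hab
    simp only [mem_filter, mem_univ, true_and] at ha hb
    exact Sum.inl_injective ((hT2 i).1 _ ha _ hb (congrArg some hab))
  · intro v hv
    refine (hT2 i).2 (some v) (hv.lift some ?_)
    rintro _ _ ⟨a, ha, rfl, rfl⟩
    exact ⟨Sum.inl a, by simpa using ha, rfl, rfl⟩
  · refine disjoint_left.2 fun a ha hb => ?_
    simp only [mem_filter, mem_univ, true_and] at ha hb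
    exact disjoint_left.1 (hT3 i j hij) ha hb
  · ext a
    have ha : Sum.inl a ∈ univ.biUnion T := hcover ▸ mem_univ _
    simpa using ha

/-- If the root sets of a decomposition into branchings have average size at least `c`, then the
decomposition can be rearranged so that each of them has size at least `c`. -/
theorem IsBranchingDecomposition.exists_forall_le_card_roots {ι : Type} [Fintype ι]
    [DecidableEq ι] {tl hd : A → V} {B : ι → Finset A} (hB : IsBranchingDecomposition tl hd B)
    {c : ℕ} (hc : Fintype.card A + Fintype.card ι * c ≤ Fintype.card ι * Fintype.card V) :
    ∃ C : ι → Finset A, IsBranchingDecomposition tl hd C ∧ ∀ i, c ≤ (roots hd (C i)).card := by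
  induction hn : ∑ i, (c - (roots hd (B i)).card) using Nat.strong_induction_on generalizing B with
  | _ n ih =>
  by_cases hall : ∀ i, c ≤ (roots hd (B i)).card
  · exact ⟨B, hB, hall⟩
  push Not at hall
  obtain ⟨j, hj⟩ := hall
  obtain ⟨i, hi⟩ : ∃ i, c < (roots hd (B i)).card := by
    by_contra! hle
    have h1 : ∑ i, (roots hd (B i)).card < ∑ _i : ι, c :=
      sum_lt_sum (fun i _ => hle i) ⟨j, mem_univ j, hj⟩
    have h2 := hB.sum_card_roots_add
    simp only [sum_const, card_univ, smul_eq_mul] at h1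
    omega
  have hij : i ≠ j := by
    rintro rfl
    omega
  obtain ⟨B', C', hB', hC', hdis, hun, hrB, hrC⟩ :=
    exists_exchange (hB.1 i) (hB.1 j) (hB.2.1 i j hij) (hj.trans hi)
  let D : ι → Finset A := fun l => if l = i then B' else if l = j then C' else B l
  have hDi : D i = B' := by simp [D]
  have hDj : D j = C' := by simp [D, hij.symm]
  have hDl : ∀ l, l ≠ i → l ≠ j → D l = B l := fun l h1 h2 => by simp [D, h1, h2]
  have hmem : ∀ a, a ∈ B' ∨ a ∈ C' ↔ a ∈ B i ∨ a ∈ B j := by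
    intro a
    rw [← mem_union, ← mem_union, hun]
  have hother : ∀ l, l ≠ i → l ≠ j → ∀ a ∈ B l, a ∉ B' ∧ a ∉ C' := by
    intro l hli hlj a ha
    rw [← not_or, hmem, not_or]
    exact ⟨disjoint_left.1 (hB.2.1 l i hli) ha, disjoint_left.1 (hB.2.1 l j hlj) ha⟩
  have hD : IsBranchingDecomposition tl hd D := by
    refine ⟨fun l => ?_, fun l m hlm => ?_, ?_⟩
    · rcases eq_or_ne l i with rfl | hli
      · rwa [hDi]
      rcases eq_or_ne l j with rfl | hlj
      · rwa [hDj]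
      rw [hDl l hli hlj]
      exact hB.1 l
    · rw [disjoint_left]
      rcases eq_or_ne l i with rfl | hli
      · rcases eq_or_ne m j with rfl | hmj
        · rw [hDi, hDj]
          exact disjoint_left.1 hdis
        · rw [hDi, hDl m hlm.symm hmj]
          exact fun a ha hm => (hother m hlm.symm hmj a hm).1 ha
      rcases eq_or_ne l j with rfl | hlj
      · rcases eq_or_ne m i with rfl | hmi
        · rw [hDi, hDj]
          exact disjoint_right.1 hdis
        · rw [hDj, hDl m hmi hlm.symm]
          exact fun a ha hm => (hother m hmi hlm.symm a hm).2 ha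
      rw [hDl l hli hlj]
      rcases eq_or_ne m i with rfl | hmi
      · rw [hDi]
        exact fun a ha => (hother l hli hlj a ha).1
      rcases eq_or_ne m j with rfl | hmj
      · rw [hDj]
        exact fun a ha => (hother l hli hlj a ha).2
      rw [hDl m hmi hmj]
      exact disjoint_left.1 (hB.2.1 l m hlm)
    · refine eq_univ_of_forall fun a => ?_
      obtain ⟨l, -, hl⟩ := mem_biUnion.1 (hB.2.2 ▸ mem_univ a : a ∈ univ.biUnion B)
      have hBC : a ∈ B i ∨ a ∈ B j → a ∈ univ.biUnion D := by
        rw [← hmem]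
        rintro (h | h)
        · exact mem_biUnion.2 ⟨i, mem_univ i, hDi ▸ h⟩
        · exact mem_biUnion.2 ⟨j, mem_univ j, hDj ▸ h⟩
      rcases eq_or_ne l i with rfl | hli
      · exact hBC (Or.inl hl)
      rcases eq_or_ne l j with rfl | hlj
      · exact hBC (Or.inr hl)
      exact mem_biUnion.2 ⟨l, mem_univ l, hDl l hli hlj ▸ hl⟩
  refine ih _ ?_ hD rfl
  rw [← hn]
  refine sum_lt_sum (fun l _ => ?_) ⟨j, mem_univ j, ?_⟩
  · rcases eq_or_ne l i with rfl | hli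
    · rw [hDi]
      omega
    rcases eq_or_ne l j with rfl | hlj
    · rw [hDj]
      omega
    rw [hDl l hli hlj]
  · rw [hDj]
    omega

end

/-- **Theorem (decomposition into `k` branchings with at least `c` roots each).**
The arc set of `D` can be partitioned into `k` branchings, each with at least
`c` roots, iff `Δ⁻(D) ≤ k`, the fractional arboricity of `D` is at most `k`
(i.e. every nonempty `X ⊆ V` induces at most `k(|X|−1)` arcs), and
`|E(D)| ≤ k(|V(D)| − c)`. -/
theorem decomposition_into_branchings_with_many_roots
    {V A : Type} [Fintype V] [DecidableEq V] [Fintype A] [DecidableEq A]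
    (tl hd : A → V) (hloop : ∀ a, tl a ≠ hd a)
    (k c : ℕ) (hk : 0 < k) (hc : 0 < c) :
    (∃ B : Fin k → Finset A,
        (∀ i, IsBranching tl hd (B i)) ∧
        (∀ i j, i ≠ j → Disjoint (B i) (B j)) ∧
        Finset.univ.biUnion B = (Finset.univ : Finset A) ∧
        (∀ i, c ≤ (roots hd (B i)).card)) ↔
    ((∀ v : V, (Finset.univ.filter fun a : A => hd a = v).card ≤ k) ∧
      (∀ X : Finset V, X.Nonempty →
        (Finset.univ.filter fun a : A => tl a ∈ X ∧ hd a ∈ X).card ≤ k * (X.card - 1)) ∧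
      ((Fintype.card A : ℤ) ≤ (k : ℤ) * ((Fintype.card V : ℤ) - (c : ℤ)))) := by
  constructor
  · rintro ⟨B, hB1, hB2, hB3, hB4⟩
    have hB : IsBranchingDecomposition tl hd B := ⟨hB1, hB2, hB3⟩
    refine ⟨fun v => ?_, fun X hX => ?_, ?_⟩
    · rw [← hB.sum_card_filter fun a => hd a = v]
      refine (sum_le_card_nsmul univ _ 1 fun i _ => card_le_one.2 fun a ha b hb => ?_).trans
        (by simp)
      rw [mem_filter] at ha hb
      exact (hB1 i).1 a ha.1 b hb.1 (ha.2.trans hb.2.symm)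
    · rw [← hB.sum_card_filter fun a => tl a ∈ X ∧ hd a ∈ X]
      exact (sum_le_card_nsmul univ _ _ fun i _ => (hB1 i).card_induced_le hX).trans (by simp)
    · have h1 := hB.sum_card_roots_add
      have h2 := card_nsmul_le_sum univ _ c fun i _ => hB4 i
      rw [card_univ, smul_eq_mul] at h2
      rw [Fintype.card_fin] at h1 h2
      zify at h1 h2
      linarith
  · rintro ⟨hdeg, harb, hcard⟩
    obtain ⟨B, hB⟩ := exists_isBranchingDecomposition (ι := Fin k) tl hd (by simpa using hdeg)
      (by simpa using harb)
    obtain ⟨C, ⟨hC1, hC2, hC3⟩, hC4⟩ := hB.exists_forall_le_card_roots (c := c) (by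
      rw [Fintype.card_fin]
      zify
      linarith)
    exact ⟨C, hC1, hC2, hC3, hC4⟩
end

section
/- Let D = (V+x, A) be a digraph and F₁, …, F_k pairwise arc-disjoint x-arborescences in D. Let G₀ = ([k], V; E₀) be the bipartite graph with an edge iv if and only if v ∈ V(F_i), and let E* be the edge set of the complete bipartite graph with parts [k] and V. Then F₁, …, F_k can be completed to k pairwise arc-disjoint spanning x-arborescences if and only if there exists E ⊆ E* such that: (i) the bipartite graph G⁺ = ([k], V; E₀ ∪ E) is simple and covers the set function X ↦ k − d⁻_{A∖(∪ᵢF_i ∪ E⁺(x))}(X) on nonempty subsets of V; and (ii) d_E(v) ≤ w_{[k]}(v) for every v ∈ V, where d_E(v) is the number of edges of E incident with v. -/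
open Finset

section ArbSetup

variable {V A : Type} [Fintype V] [DecidableEq V] [Fintype A] [DecidableEq A]

/-- One arc-step within the arc set `F`: there is an arc of `F` from `u` to `v`.
The digraph is `D = (V + x, A)`, where the extra root vertex `x` is modelled by
`none : Option V`. -/
def ArcStep (tl hd : A → Option V) (F : Finset A) (u v : Option V) : Prop :=
  ∃ a ∈ F, tl a = u ∧ hd a = v

/-- `F` is an `x`-arborescence (rooted at `x = none`): no arc enters the root,
every vertex has in-degree at most one, and the tail of every arc is reachable
from the root inside `F`.  (Equivalently: the underlying graph is a tree and for
each vertex of `F` there is exactly one directed path from `x` to it.) -/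
def IsArborescence (tl hd : A → Option V) (F : Finset A) : Prop :=
  (∀ a ∈ F, hd a ≠ none) ∧
  (∀ a ∈ F, ∀ b ∈ F, hd a = hd b → a = b) ∧
  (∀ a ∈ F, Relation.ReflTransGen (ArcStep tl hd F) none (tl a))

/-- The vertex set `V(F)` of an `x`-arborescence `F` (by convention it always
contains the root `x = none`). -/
def arbVerts (tl hd : A → Option V) (F : Finset A) : Finset (Option V) :=
  insert none (F.image tl ∪ F.image hd)

/-- `F` is spanning: `V(F) = V + x`. -/
def IsSpanning (tl hd : A → Option V) (F : Finset A) : Prop :=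
  arbVerts tl hd F = Finset.univ

/-- `d⁺_F(x)`: the number of arcs of `F` with tail `x = none`. -/
def rootDeg (tl : A → Option V) (F : Finset A) : ℕ :=
  (F.filter fun a => tl a = none).card

/-- `d⁻_{A₀}(X)` for `X ⊆ V`: the number of arcs of `A₀` with head in `X` and
tail outside of `X`. -/
def dIn (tl hd : A → Option V) (A₀ : Finset A) (X : Finset V) : ℕ :=
  (A₀.filter fun a => hd a ∈ X.image some ∧ tl a ∉ X.image some).card

/-- `[x,u]_{A₀}`: the number of arcs of `A₀` from `x` to `u`. -/
def parCount (tl hd : A → Option V) (A₀ : Finset A) (u : V) : ℕ :=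
  (A₀.filter fun a => tl a = none ∧ hd a = some u).card

/-- `A ∖ ∪ᵢ Fᵢ`. -/
def restArcs {k : ℕ} (F : Fin k → Finset A) : Finset A :=
  Finset.univ \ Finset.univ.biUnion F

/-- `A ∖ (∪ᵢ Fᵢ ∪ E⁺(x))`. -/
def restArcs' {k : ℕ} (tl : A → Option V) (F : Fin k → Finset A) : Finset A :=
  Finset.univ \ (Finset.univ.biUnion F ∪ Finset.univ.filter fun a => tl a = none)

/-- `|P_I(X)| = |{ i ∈ I : X ∩ V(Fᵢ) = ∅ }|`. -/
def PIcard {k : ℕ} (tl hd : A → Option V) (F : Fin k → Finset A)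
    (I : Finset (Fin k)) (X : Finset V) : ℕ :=
  (I.filter fun i => ∀ v ∈ X, some v ∉ arbVerts tl hd (F i)).card

/-- `w_I(u) = min{ |{i ∈ I : u ∉ V(Fᵢ)}| , [x,u]_{A ∖ ∪ᵢFᵢ} }` if `u ∈ N⁺(x)`,
and `0` otherwise. -/
def wI {k : ℕ} (tl hd : A → Option V) (F : Fin k → Finset A)
    (I : Finset (Fin k)) (u : V) : ℕ :=
  if ∃ a : A, tl a = none ∧ hd a = some u then
    min ((I.filter fun i => some u ∉ arbVerts tl hd (F i)).card)
        (parCount tl hd (restArcs F) u)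
  else 0

end ArbSetup

/-- `Γ_G(X)`, the set of left-vertices having a neighbour in `X ⊆ T`, for a
(simple) bipartite graph given by its edge set `G ⊆ S × T`. -/
def nbhd {S T : Type} [DecidableEq S] [DecidableEq T]
    (G : Finset (S × T)) (X : Finset T) : Finset S :=
  (G.filter fun p => p.2 ∈ X).image Prod.fst

section ArcPacking

variable {W A ι : Type} [DecidableEq W] [Fintype ι]

/-- The number of arcs of `B` entering the vertex set `X`. -/
def inCount (tl hd : A → W) (B : Finset A) (X : Finset W) : ℕ :=
  (B.filter fun a => hd a ∈ X ∧ tl a ∉ X).card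

/-- The number of members of the family `U` that avoid `X`. -/
def missCount (U : ι → Finset W) (X : Finset W) : ℕ :=
  (univ.filter fun i => Disjoint X (U i)).card

theorem inCount_submodular (tl hd : A → W) (B : Finset A) (X Y : Finset W) :
    inCount tl hd B (X ∩ Y) + inCount tl hd B (X ∪ Y) ≤
      inCount tl hd B X + inCount tl hd B Y := by
  simp only [inCount, Finset.card_filter, ← Finset.sum_add_distrib]
  refine Finset.sum_le_sum fun a _ => ?_
  by_cases h1 : hd a ∈ X <;> by_cases h2 : hd a ∈ Y <;> by_cases h3 : tl a ∈ X <;>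
    by_cases h4 : tl a ∈ Y <;> simp [h1, h2, h3, h4]

theorem disjoint_indicator_supermodular (X Y U : Finset W) :
    (if Disjoint X U then 1 else 0) + (if Disjoint Y U then 1 else 0) ≤
      (if Disjoint (X ∩ Y) U then 1 else 0) + (if Disjoint (X ∪ Y) U then 1 else 0) := by
  have hX : Disjoint X U → Disjoint (X ∩ Y) U := fun h => h.mono_left inter_subset_left
  have hY : Disjoint Y U → Disjoint (X ∩ Y) U := fun h => h.mono_left inter_subset_right
  by_cases h1 : Disjoint X U <;> by_cases h2 : Disjoint Y U <;>
    simp [Finset.disjoint_union_left, h1, h2, hX, hY]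

theorem missCount_supermodular (U : ι → Finset W) (X Y : Finset W) :
    missCount U X + missCount U Y ≤ missCount U (X ∩ Y) + missCount U (X ∪ Y) := by
  simp only [missCount, Finset.card_filter, ← Finset.sum_add_distrib]
  exact Finset.sum_le_sum fun j _ => disjoint_indicator_supermodular X Y (U j)

/-- `missCount` is strictly supermodular on two sets if some `U i` meets both of them but not
their intersection. -/
theorem missCount_supermodular_strict (U : ι → Finset W) {X Y : Finset W} {i : ι}
    (hX : ¬ Disjoint X (U i)) (hY : ¬ Disjoint Y (U i)) (hXY : Disjoint (X ∩ Y) (U i)) :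
    missCount U X + missCount U Y < missCount U (X ∩ Y) + missCount U (X ∪ Y) := by
  simp only [missCount, Finset.card_filter, ← Finset.sum_add_distrib]
  refine Finset.sum_lt_sum (fun j _ => disjoint_indicator_supermodular X Y (U j))
    ⟨i, mem_univ i, ?_⟩
  simp [hX, hY, hXY]

/-- If `X`, in case `a` enters it, is disjoint from `U i` or has slack in the cut condition,
then the cut condition at `X` survives moving `a` from `B` to the `i`-th member. -/
theorem cut_condition_update [DecidableEq A] [DecidableEq ι] {tl hd : A → W} {B : Finset A}
    {U : ι → Finset W} {X : Finset W} {i : ι} {a : A}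
    (hcut : missCount U X ≤ inCount tl hd B X)
    (hgood : hd a ∈ X → tl a ∉ X → Disjoint X (U i) ∨ missCount U X < inCount tl hd B X) :
    missCount (Function.update U i (insert (hd a) (U i))) X ≤ inCount tl hd (B.erase a) X := by
  have hsub : (univ.filter fun j => Disjoint X (Function.update U i (insert (hd a) (U i)) j)) ⊆
      univ.filter fun j => Disjoint X (U j) := by
    intro j hj
    simp only [mem_filter, mem_univ, true_and] at hj ⊢
    rcases eq_or_ne j i with rfl | hji
    · rw [Function.update_self] at hj
      exact hj.mono_right (subset_insert _ _)
    · rwa [Function.update_of_ne hji] at hj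
  have hle : missCount (Function.update U i (insert (hd a) (U i))) X ≤ missCount U X :=
    card_le_card hsub
  by_cases hent : hd a ∈ X ∧ tl a ∉ X
  · have herase : inCount tl hd B X - 1 ≤ inCount tl hd (B.erase a) X := by
      unfold inCount
      rw [Finset.filter_erase]
      exact Finset.pred_card_le_card_erase
    rcases hgood hent.1 hent.2 with hdis | hlt
    · have hlt : missCount (Function.update U i (insert (hd a) (U i))) X < missCount U X := by
        refine card_lt_card ⟨hsub, fun h => ?_⟩
        have := h (mem_filter.2 ⟨mem_univ i, hdis⟩)
        rw [mem_filter, Function.update_self] at this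
        exact Finset.disjoint_left.1 this.2 hent.1 (mem_insert_self _ _)
      omega
    · omega
  · have : inCount tl hd (B.erase a) X = inCount tl hd B X := by
      unfold inCount
      rw [Finset.filter_erase, Finset.erase_eq_of_notMem]
      simp [hent]
    omega

/-- The augmentation step of Lovász's proof of Edmonds' disjoint branchings theorem. -/
theorem exists_augmenting_arc [Fintype W] [DecidableEq A] [DecidableEq ι] {tl hd : A → W}
    {B : Finset A} {U : ι → Finset W}
    (hcut : ∀ X : Finset W, X.Nonempty → missCount U X ≤ inCount tl hd B X)
    {i : ι} (hi : U i ≠ univ) :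
    ∃ a ∈ B, tl a ∈ U i ∧ hd a ∉ U i ∧ ∀ X : Finset W, X.Nonempty →
      missCount (Function.update U i (insert (hd a) (U i))) X ≤
        inCount tl hd (B.erase a) X := by
  obtain ⟨w, hw⟩ : ∃ w, w ∉ U i := by
    by_contra! h
    exact hi (eq_univ_iff_forall.2 h)
  set T : Finset (Finset W) := univ.filter fun X =>
    inCount tl hd B X ≤ missCount U X ∧ ¬ Disjoint X (U i) ∧ (X \ U i).Nonempty with hT
  have huniv : inCount tl hd B univ = 0 := by simp [inCount]
  have hTne : T.Nonempty := by
    refine ⟨univ, ?_⟩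
    simp only [hT, mem_filter, mem_univ, true_and, huniv, Nat.zero_le]
    refine ⟨fun hdis => ?_, w, by simpa using hw⟩
    have h0 := hcut univ ⟨w, mem_univ w⟩
    rw [huniv, Nat.le_zero, missCount, card_eq_zero] at h0
    exact notMem_empty i (h0 ▸ mem_filter.2 ⟨mem_univ i, hdis⟩)
  obtain ⟨X, hXT, hXmin⟩ := T.exists_min_image card hTne
  simp only [hT, mem_filter, mem_univ, true_and] at hXT hXmin
  obtain ⟨hXtight, hXmeet, hXout⟩ := hXT
  have hmiss : missCount U X < missCount U (X \ U i) := by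
    refine card_lt_card ⟨fun j hj => ?_, fun h => ?_⟩
    · simp only [mem_filter, mem_univ, true_and] at hj ⊢
      exact hj.mono_left sdiff_subset
    · exact hXmeet (mem_filter.1 (h (mem_filter.2 ⟨mem_univ i, sdiff_disjoint⟩))).2
  have hin : inCount tl hd B X < inCount tl hd B (X \ U i) :=
    lt_of_le_of_lt hXtight (hmiss.trans_le (hcut _ hXout))
  obtain ⟨a, ha, haX⟩ := exists_mem_notMem_of_card_lt_card hin
  simp only [mem_filter, mem_sdiff, not_and, not_not] at ha haX
  obtain ⟨haB, ⟨hhX, hhU⟩, htl⟩ := ha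
  have htX : tl a ∈ X := haX haB hhX
  have htU : tl a ∈ U i := htl htX
  refine ⟨a, haB, htU, hhU, fun Y hY => cut_condition_update (hcut Y hY) fun hhY htY => ?_⟩
  by_contra! hbad
  obtain ⟨hYmeet, hYtight⟩ := hbad
  have hIne : (X ∩ Y).Nonempty := ⟨hd a, mem_inter.2 ⟨hhX, hhY⟩⟩
  have hsub := inCount_submodular tl hd B X Y
  have hI := hcut (X ∩ Y) hIne
  have hUn := hcut (X ∪ Y) (hIne.mono (inter_subset_left.trans subset_union_left))
  have hsup := missCount_supermodular U X Y
  have hImeet : ¬ Disjoint (X ∩ Y) (U i) := fun hdis => by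
    have := missCount_supermodular_strict U hXmeet hYmeet hdis
    omega
  have hcard := hXmin (X ∩ Y) ⟨by omega, hImeet, hd a, by simp [hhX, hhY, hhU]⟩
  have hlt : (X ∩ Y).card < X.card :=
    card_lt_card ⟨inter_subset_left, fun h => htY (mem_inter.1 (h htX)).2⟩
  omega

end ArcPacking

/-- A path that ends in `S` but does not start there has a step entering `S`. -/
theorem Relation.ReflTransGen.exists_step_into {α : Type} {r : α → α → Prop} {u v : α}
    (h : Relation.ReflTransGen r u v) {S : α → Prop} (hu : ¬ S u) (hv : S v) :
    ∃ b c, r b c ∧ ¬ S b ∧ S c := by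
  induction h with
  | refl => exact absurd hv hu
  | @tail b c _ hbc ih =>
    by_cases hb : S b
    · exact ih hb
    · exact ⟨b, c, hbc, hb, hv⟩

/-- An index set is no larger than a set meeting each of the corresponding members of
a pairwise disjoint family. -/
theorem card_le_card_of_disjoint_family {ι A : Type} {Fs : ι → Finset A}
    (hdisj : ∀ i j, i ≠ j → Disjoint (Fs i) (Fs j)) {s : Finset ι} {t : Finset A}
    (h : ∀ i ∈ s, ∃ a ∈ t, a ∈ Fs i) : s.card ≤ t.card := by
  refine card_le_card_of_forall_subsingleton (fun i a => a ∈ Fs i) h fun a _ i hi j hj => ?_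
  by_contra hij
  exact Finset.disjoint_left.1 (hdisj i j hij) hi.2 hj.2

section Arborescence

variable {V A : Type} {tl hd : A → Option V}

theorem hd_mem_arbVerts [DecidableEq V] {F : Finset A} {a : A} (ha : a ∈ F) :
    hd a ∈ arbVerts tl hd F := by
  simp only [arbVerts, mem_insert, mem_union, mem_image]
  exact Or.inr (Or.inr ⟨a, ha, rfl⟩)

theorem ArcStep.mono {F G : Finset A} (h : F ⊆ G) {u v : Option V}
    (huv : ArcStep tl hd F u v) : ArcStep tl hd G u v := by
  obtain ⟨a, ha, hav⟩ := huv
  exact ⟨a, h ha, hav⟩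

theorem IsArborescence.reachable [DecidableEq V] {F : Finset A} (hF : IsArborescence tl hd F)
    {u : Option V} (hu : u ∈ arbVerts tl hd F) : Relation.ReflTransGen (ArcStep tl hd F) none u := by
  simp only [arbVerts, mem_insert, mem_union, mem_image] at hu
  rcases hu with rfl | ⟨a, ha, rfl⟩ | ⟨a, ha, rfl⟩
  · exact .refl
  · exact hF.2.2 a ha
  · exact (hF.2.2 a ha).tail ⟨a, ha, rfl, rfl⟩

theorem arbVerts_insert [DecidableEq V] [DecidableEq A] {F : Finset A} {a : A}
    (ha : tl a ∈ arbVerts tl hd F) :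
    arbVerts tl hd (insert a F) = insert (hd a) (arbVerts tl hd F) := by
  rw [← insert_eq_of_mem ha]
  ext u
  simp only [arbVerts, mem_insert, mem_union, image_insert]
  tauto

theorem IsArborescence.insert [DecidableEq V] [DecidableEq A] {F : Finset A} (hF : IsArborescence tl hd F)
    {a : A} (htl : tl a ∈ arbVerts tl hd F) (hhd : hd a ∉ arbVerts tl hd F) :
    IsArborescence tl hd (insert a F) := by
  refine ⟨fun b hb => ?_, fun b hb c hc hbc => ?_, fun b hb => ?_⟩
  · rcases mem_insert.1 hb with rfl | hb
    · exact fun h => hhd (by simp [arbVerts, h])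
    · exact hF.1 b hb
  · rcases mem_insert.1 hb with rfl | hb' <;> rcases mem_insert.1 hc with rfl | hc'
    · rfl
    · exact absurd (hbc ▸ hd_mem_arbVerts hc') hhd
    · exact absurd (hbc ▸ hd_mem_arbVerts hb') hhd
    · exact hF.2.1 b hb' c hc' hbc
  · have hreach : Relation.ReflTransGen (ArcStep tl hd F) none (tl b) := by
      rcases mem_insert.1 hb with rfl | hb
      · exact hF.reachable htl
      · exact hF.2.2 b hb
    exact Relation.ReflTransGen.mono (fun _ _ => ArcStep.mono (subset_insert _ _)) _ _ hreach

/-- Edmonds' theorem: arc-disjoint arborescences can be completed to arc-disjoint spanning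
ones by arcs of `B` as soon as the cut condition holds. -/
theorem exists_spanning_completion [Fintype V] [DecidableEq V] [DecidableEq A]
    {ι : Type} [Fintype ι] (B : Finset A) (F : ι → Finset A)
    (harb : ∀ i, IsArborescence tl hd (F i))
    (hdisj : ∀ i j, i ≠ j → Disjoint (F i) (F j))
    (hB : ∀ i, Disjoint B (F i))
    (hcut : ∀ X : Finset (Option V), X.Nonempty →
      missCount (fun i => arbVerts tl hd (F i)) X ≤ inCount tl hd B X) :
    ∃ Fs : ι → Finset A,
      (∀ i, F i ⊆ Fs i) ∧
      (∀ i, IsArborescence tl hd (Fs i)) ∧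
      (∀ i, IsSpanning tl hd (Fs i)) ∧
      (∀ i j, i ≠ j → Disjoint (Fs i) (Fs j)) := by
  classical
  induction B using Finset.strongInduction generalizing F with
  | H B ih =>
    by_cases hsp : ∀ i, IsSpanning tl hd (F i)
    · exact ⟨F, fun i => Subset.rfl, harb, hsp, hdisj⟩
    push Not at hsp
    obtain ⟨i, hi⟩ := hsp
    obtain ⟨a, haB, htl, hhd, hnew⟩ := exists_augmenting_arc hcut hi
    have haF : ∀ j, a ∉ F j := fun j => Finset.disjoint_left.1 (hB j) haB
    have hF' : ∀ j, (j = i ∧ Function.update F i (insert a (F i)) j = insert a (F j)) ∨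
        (j ≠ i ∧ Function.update F i (insert a (F i)) j = F j) := by
      intro j
      rcases eq_or_ne j i with rfl | hj
      · exact Or.inl ⟨rfl, Function.update_self ..⟩
      · exact Or.inr ⟨hj, Function.update_of_ne hj ..⟩
    have hsub : ∀ j, F j ⊆ Function.update F i (insert a (F i)) j := by
      intro j
      rcases hF' j with ⟨_, h⟩ | ⟨_, h⟩ <;> rw [h]
      exact subset_insert _ _
    refine (ih (B.erase a) (erase_ssubset haB) (Function.update F i (insert a (F i)))
      ?_ ?_ ?_ ?_).imp fun Fs h => ⟨fun j => (hsub j).trans (h.1 j), h.2⟩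
    · intro j
      rcases hF' j with ⟨rfl, h⟩ | ⟨_, h⟩ <;> rw [h]
      · exact (harb j).insert htl hhd
      · exact harb j
    · intro j l hjl
      rcases hF' j with ⟨hj, h⟩ | ⟨_, h⟩ <;> rcases hF' l with ⟨hl, h'⟩ | ⟨_, h'⟩ <;> rw [h, h']
      · exact absurd (hj.trans hl.symm) hjl
      · exact disjoint_insert_left.2 ⟨haF l, hdisj j l hjl⟩
      · exact disjoint_insert_right.2 ⟨haF j, hdisj j l hjl⟩
      · exact hdisj j l hjl
    · intro j
      rcases hF' j with ⟨_, h⟩ | ⟨_, h⟩ <;> rw [h]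
      · exact disjoint_insert_right.2
          ⟨notMem_erase a B, (hB j).mono_left (erase_subset _ _)⟩
      · exact (hB j).mono_left (erase_subset _ _)
    · have hU : (fun j => arbVerts tl hd (Function.update F i (insert a (F i)) j)) =
          Function.update (fun j => arbVerts tl hd (F j)) i
            (insert (hd a) (arbVerts tl hd (F i))) := by
        funext j
        rcases hF' j with ⟨rfl, h⟩ | ⟨hj, h⟩ <;> rw [h]
        · rw [Function.update_self, arbVerts_insert htl]
        · rw [Function.update_of_ne hj]
      rw [hU]
      exact hnew

/-- If at most `[x,v]_R` elements of `E` lie over each vertex `v`, then they can be represented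
by distinct root arcs of `R`. -/
theorem exists_injective_root_arcs [DecidableEq V] {ι : Type} {R : Finset A} {E : Finset (ι × V)}
    (hE : ∀ v, (E.filter fun p => p.2 = v).card ≤ parCount tl hd R v) :
    ∃ g : E → A, Function.Injective g ∧
      ∀ p, g p ∈ R ∧ tl (g p) = none ∧ hd (g p) = some p.1.2 := by
  have hemb : ∀ v, Nonempty ((E.filter fun p => p.2 = v) ↪
      (R.filter fun a => tl a = none ∧ hd a = some v : Finset A)) := fun v =>
    Function.Embedding.nonempty_of_card_le (by simpa only [parCount, Fintype.card_coe] using hE v)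
  let e := fun v => (hemb v).some
  have hg : ∀ p : E, p.1 ∈ E.filter fun q => q.2 = p.1.2 := fun p =>
    mem_filter.2 ⟨p.2, rfl⟩
  have hspec : ∀ p : E, (e p.1.2 ⟨p.1, hg p⟩ : A) ∈ R ∧ tl (e p.1.2 ⟨p.1, hg p⟩) = none ∧
      hd (e p.1.2 ⟨p.1, hg p⟩) = some p.1.2 := fun p =>
    mem_filter.1 (e p.1.2 ⟨p.1, hg p⟩).2
  refine ⟨fun p => e p.1.2 ⟨p.1, hg p⟩, ?_, hspec⟩
  rintro ⟨⟨i, v⟩, hp⟩ ⟨⟨j, u⟩, hq⟩ hpq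
  obtain rfl : v = u := by
    exact Option.some.inj
      ((hspec ⟨(i, v), hp⟩).2.2.symm.trans ((congrArg hd hpq).trans (hspec ⟨(j, u), hq⟩).2.2))
  have := (e v).injective (Subtype.ext hpq)
  simpa using this

end Arborescence

/-- **Lemma (bipartite reformulation of arborescence completion).**
Arc-disjoint `x`-arborescences `F₁, …, F_k` can be completed to `k`
arc-disjoint spanning `x`-arborescences iff there is an edge set `E ⊆ E*`
(of the complete bipartite graph on `[k]` and `V`) such that
(i) `G⁺ = ([k], V; E₀ ∪ E)` is simple (i.e. `E` is disjoint from
`E₀ = {iv : v ∈ V(Fᵢ)}`) and covers `X ↦ k − d⁻_{A∖(∪Fᵢ ∪ E⁺(x))}(X)`, and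
(ii) `d_E(v) ≤ w_{[k]}(v)` for all `v ∈ V`. -/
theorem arborescence_completion_via_bipartite_cover
    {V A : Type} [Fintype V] [DecidableEq V] [Fintype A] [DecidableEq A]
    (tl hd : A → Option V) (hloop : ∀ a, tl a ≠ hd a)
    (k : ℕ)
    (F : Fin k → Finset A)
    (harb : ∀ i, IsArborescence tl hd (F i))
    (hFdisj : ∀ i j, i ≠ j → Disjoint (F i) (F j)) :
    (∃ Fs : Fin k → Finset A,
        (∀ i, F i ⊆ Fs i) ∧
        (∀ i, IsArborescence tl hd (Fs i)) ∧
        (∀ i, IsSpanning tl hd (Fs i)) ∧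
        (∀ i j, i ≠ j → Disjoint (Fs i) (Fs j))) ↔
    (∃ E : Finset (Fin k × V),
        Disjoint E (Finset.univ.filter fun p : Fin k × V =>
          some p.2 ∈ arbVerts tl hd (F p.1)) ∧
        (∀ X : Finset V, X.Nonempty →
          (k : ℤ) - (dIn tl hd (restArcs' tl F) X : ℤ)
            ≤ ((nbhd ((Finset.univ.filter fun p : Fin k × V =>
                  some p.2 ∈ arbVerts tl hd (F p.1)) ∪ E) X).card : ℤ)) ∧
        (∀ v : V, (E.filter fun p => p.2 = v).card ≤ wI tl hd F Finset.univ v)) := by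
  set E₀ := Finset.univ.filter fun p : Fin k × V => some p.2 ∈ arbVerts tl hd (F p.1) with hE₀
  have hnb : ∀ (E : Finset (Fin k × V)) (X : Finset V) (i : Fin k), i ∈ nbhd (E₀ ∪ E) X ↔
      ∃ v ∈ X, some v ∈ arbVerts tl hd (F i) ∨ (i, v) ∈ E := by
    intro E X i
    simp only [nbhd, hE₀, mem_image, mem_filter, mem_union, mem_univ, true_and, Prod.exists,
      exists_and_right, exists_eq_right]
    exact exists_congr fun v => and_comm
  have hcompl : ∀ S : Finset (Fin k), (univ \ S).card + S.card = k := fun S => by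
    simpa using card_sdiff_add_card_eq_card (subset_univ S)
  constructor
  · rintro ⟨Fs, hsub, hFs, hspan, hdisj⟩
    have hown : ∀ i j a, a ∈ Fs i → a ∈ F j → a ∈ F i := fun i j a hi hj => by
      obtain rfl : j = i := by
        by_contra hji
        exact Finset.disjoint_left.1 (hdisj j i hji) (hsub j hj) hi
      exact hj
    set E : Finset (Fin k × V) := univ.filter fun p => some p.2 ∉ arbVerts tl hd (F p.1) ∧
      ∃ a ∈ Fs p.1, tl a = none ∧ hd a = some p.2 with hE
    refine ⟨E, ?_, fun X hX => ?_, fun v => ?_⟩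
    · rw [Finset.disjoint_left]
      intro p hp hp'
      exact (mem_filter.1 hp).2.1 (mem_filter.1 hp').2
    · have hle : (univ \ nbhd (E₀ ∪ E) X).card ≤ dIn tl hd (restArcs' tl F) X := by
        refine card_le_card_of_disjoint_family hdisj fun i hi => ?_
        have hi' : i ∉ nbhd (E₀ ∪ E) X := (mem_sdiff.1 hi).2
        rw [hnb] at hi'
        push Not at hi'
        obtain ⟨v, hv⟩ := hX
        have hreach := (hFs i).reachable (u := some v) (by rw [hspan i]; exact mem_univ _)
        obtain ⟨_, _, ⟨a, ha, rfl, rfl⟩, htl, hhd⟩ :=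
          hreach.exists_step_into (S := fun u => u ∈ X.image some) (by simp)
            (mem_image_of_mem _ hv)
        refine ⟨a, mem_filter.2 ⟨?_, hhd, htl⟩, ha⟩
        obtain ⟨u, hu, hua⟩ := mem_image.1 hhd
        simp only [restArcs', mem_sdiff, mem_univ, true_and, mem_union, mem_biUnion, mem_filter,
          not_or, not_exists]
        refine ⟨fun j hj => ?_, fun h => ?_⟩
        · exact (hi' u hu).1 (hua ▸ hd_mem_arbVerts (hown i j a ha hj))
        · exact (hi' u hu).2 (mem_filter.2 ⟨mem_univ _, (hi' u hu).1, a, ha, h, hua.symm⟩)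
      have := hcompl (nbhd (E₀ ∪ E) X)
      omega
    · have hmem : ∀ p ∈ E.filter fun p => p.2 = v, p.2 = v ∧ some v ∉ arbVerts tl hd (F p.1) ∧
          ∃ a ∈ Fs p.1, tl a = none ∧ hd a = some v := by
        rintro ⟨i, u⟩ hp
        simp only [hE, mem_filter, mem_univ, true_and] at hp
        obtain ⟨hp, rfl⟩ := hp
        exact ⟨rfl, hp⟩
      have himg : ((E.filter fun p => p.2 = v).image Prod.fst).card =
          (E.filter fun p => p.2 = v).card := by
        refine card_image_of_injOn fun p hp q hq hpq => Prod.ext hpq ?_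
        rw [(hmem p hp).1, (hmem q hq).1]
      unfold wI
      split_ifs with hN
      · rw [← himg]
        refine le_min (card_le_card fun i hi => ?_)
          (card_le_card_of_disjoint_family hdisj fun i hi => ?_) <;>
          obtain ⟨p, hp, rfl⟩ := mem_image.1 hi <;>
          obtain ⟨-, hv, a, ha, htl, hhd⟩ := hmem p hp
        · exact mem_filter.2 ⟨mem_univ _, hv⟩
        · refine ⟨a, mem_filter.2 ⟨?_, htl, hhd⟩, ha⟩
          simp only [restArcs, mem_sdiff, mem_univ, true_and, mem_biUnion, not_exists]
          exact fun j hj => hv (hhd ▸ hd_mem_arbVerts (hown p.1 j a ha hj))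
      · rw [Nat.le_zero, card_eq_zero, eq_empty_iff_forall_notMem]
        intro p hp
        obtain ⟨-, -, a, -, ha⟩ := hmem p hp
        exact hN ⟨a, ha⟩
  · rintro ⟨E, hEdisj, hcov, hw⟩
    have hEv : ∀ p ∈ E, some p.2 ∉ arbVerts tl hd (F p.1) := fun p hp h =>
      Finset.disjoint_left.1 hEdisj hp (mem_filter.2 ⟨mem_univ _, h⟩)
    obtain ⟨g, hginj, hg⟩ := exists_injective_root_arcs (tl := tl) (hd := hd) (R := restArcs F)
      (E := E) fun v => (hw v).trans (by unfold wI; split_ifs <;> simp)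
    have hgF : ∀ p i, g p ∉ F i := fun p i h => by
      have := (hg p).1
      simp only [restArcs, mem_sdiff, mem_univ, true_and, mem_biUnion, not_exists] at this
      exact this i h
    set F' : Fin k → Finset A := fun i =>
      F i ∪ (univ.filter fun p : E => p.1.1 = i).image g with hF'
    have hmem : ∀ i a, a ∈ F' i ↔ a ∈ F i ∨ ∃ p : E, p.1.1 = i ∧ g p = a := by
      intro i a
      simp only [hF', mem_union, mem_image, mem_filter, mem_univ, true_and]
    have hsub : ∀ i, F i ⊆ F' i := fun i => subset_union_left
    refine (exists_spanning_completion (tl := tl) (hd := hd) (restArcs' tl F) F'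
      ?_ ?_ ?_ ?_).imp fun Fs h => ⟨fun i => (hsub i).trans (h.1 i), h.2⟩
    · intro i
      refine ⟨fun a ha => ?_, fun a ha b hb hab => ?_, fun a ha => ?_⟩
      · rcases (hmem i a).1 ha with ha | ⟨p, -, rfl⟩
        · exact (harb i).1 a ha
        · simp [(hg p).2.2]
      · rcases (hmem i a).1 ha with ha | ⟨p, rfl, rfl⟩ <;>
          rcases (hmem _ b).1 hb with hb | ⟨q, hq, rfl⟩
        · exact (harb i).2.1 a ha b hb hab
        · subst hq
          exact absurd ((hab.trans (hg q).2.2) ▸ hd_mem_arbVerts ha) (hEv q.1 q.2)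
        · exact absurd ((hab.symm.trans (hg p).2.2) ▸ hd_mem_arbVerts hb) (hEv p.1 p.2)
        · rw [(hg p).2.2, (hg q).2.2] at hab
          exact congrArg g (Subtype.ext (Prod.ext hq.symm (Option.some.inj hab)))
      · rcases (hmem i a).1 ha with ha | ⟨p, -, rfl⟩
        · exact Relation.ReflTransGen.mono (fun _ _ => ArcStep.mono (hsub i)) _ _ ((harb i).2.2 a ha)
        · rw [(hg p).2.1]
    · intro i j hij
      rw [Finset.disjoint_left]
      intro a hai haj
      rcases (hmem i a).1 hai with ha | ⟨p, rfl, rfl⟩ <;>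
        rcases (hmem j _).1 haj with hb | ⟨q, rfl, hq⟩
      · exact Finset.disjoint_left.1 (hFdisj i j hij) ha hb
      · exact hgF q i (hq ▸ ha)
      · exact hgF p j hb
      · exact hij (by rw [hginj hq])
    · intro i
      rw [Finset.disjoint_left]
      intro a ha hai
      simp only [restArcs', mem_sdiff, mem_univ, true_and, mem_union, mem_biUnion, mem_filter,
        not_or, not_exists] at ha
      rcases (hmem i a).1 hai with h | ⟨p, -, rfl⟩
      · exact ha.1 i h
      · exact ha.2 (hg p).2.1
    · intro X hX
      by_cases hnone : none ∈ X
      · have : missCount (fun i => arbVerts tl hd (F' i)) X = 0 := by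
          rw [missCount, card_eq_zero, filter_eq_empty_iff]
          intro i _ h
          exact Finset.disjoint_left.1 h hnone (mem_insert_self _ _)
        omega
      · obtain ⟨Y, rfl⟩ : ∃ Y : Finset V, X = Y.image some :=
          ⟨X.eraseNone, by rw [image_some_eraseNone, erase_eq_of_notMem hnone]⟩
        have hYcov := hcov Y (image_nonempty.1 hX)
        have hle : missCount (fun i => arbVerts tl hd (F' i)) (Y.image some) ≤
            (univ \ nbhd (E₀ ∪ E) Y).card := by
          refine card_le_card fun i hi => mem_sdiff.2 ⟨mem_univ _, fun hin => ?_⟩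
          obtain ⟨v, hv, h⟩ := (hnb E Y i).1 hin
          refine Finset.disjoint_left.1 (mem_filter.1 hi).2 (mem_image_of_mem _ hv) ?_
          rcases h with h | h
          · exact insert_subset_insert _ (union_subset_union (image_subset_image (hsub i))
              (image_subset_image (hsub i))) h
          · rw [← (hg ⟨(i, v), h⟩).2.2]
            exact hd_mem_arbVerts ((hmem i _).2 (Or.inr ⟨_, rfl, rfl⟩))
        have := hcompl (nbhd (E₀ ∪ E) Y)
        change _ ≤ dIn tl hd (restArcs' tl F) Y
        omega
end

section
/- A digraph D can be decomposed into k branchings (its arc set partitioned into k pairwise arc-disjoint branchings) if and only if the maximum in-degree of D is at most k and the underlying undirected graph of D can be decomposed into k forests. -/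
open Finset

/-- The vertices covered by the edge set `E'` of the underlying undirected
(multi)graph of `D`. -/
def uverts {V A : Type} [DecidableEq V] (tl hd : A → V) (E' : Finset A) : Finset V :=
  E'.image tl ∪ E'.image hd

/-- `E₀` is a forest in the underlying undirected multigraph of `D`: every
nonempty subset of edges covers strictly more vertices than its number of
edges (equivalently, the underlying graph spanned by `E₀` has no cycle). -/
def IsForest {V A : Type} [DecidableEq V] (tl hd : A → V) (E₀ : Finset A) : Prop :=
  ∀ E' ⊆ E₀, E'.Nonempty → E'.card < (uverts tl hd E').card

section RootedArborescences

/-- The arc `a` enters the vertex set `X`. Arcs with tail `none` start at an extra root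
outside of `V`. -/
def Enters {V A : Type} (tl : A → Option V) (hd : A → V) (X : Finset V) (a : A) : Prop :=
  hd a ∈ X ∧ ∀ u ∈ X, tl a ≠ some u

/-- `T` is an arborescence rooted at the extra root `none`; `T.image hd` is the set of vertices
it reaches, and `f` increases along its arcs. -/
structure IsRootedArb {V A : Type} [DecidableEq V] (tl : A → Option V) (hd : A → V)
    (T : Finset A) : Prop where
  inj : Set.InjOn hd T
  tail_mem : ∀ a ∈ T, ∀ u, tl a = some u → u ∈ T.image hd
  rank : ∃ f : V → ℕ, ∀ a ∈ T, ∀ u, tl a = some u → f u < f (hd a)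

open Classical in
/-- The number of arcs of `E` entering `X`. -/
noncomputable def enterCard {V A : Type} (tl : A → Option V) (hd : A → V) (E : Finset A)
    (X : Finset V) : ℕ :=
  (E.filter (Enters tl hd X)).card

variable {V A : Type} {tl : A → Option V} {hd : A → V}

theorem enterCard_submodular [DecidableEq V] (E : Finset A) (X Y : Finset V) :
    enterCard tl hd E (X ∩ Y) + enterCard tl hd E (X ∪ Y) ≤
      enterCard tl hd E X + enterCard tl hd E Y := by
  classical
  simp only [enterCard, card_filter, ← sum_add_distrib]
  refine sum_le_sum fun a _ => ?_
  have hi : Enters tl hd (X ∩ Y) a → Enters tl hd X a ∨ Enters tl hd Y a := by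
    rintro ⟨h1, h2⟩
    rw [mem_inter] at h1
    by_contra! h
    simp only [Enters, h1, true_and] at h
    push Not at h
    obtain ⟨⟨u, hu, hu'⟩, ⟨w, hw, hw'⟩⟩ := h
    have : u = w := Option.some.inj (hu'.symm.trans hw')
    subst this
    exact h2 u (mem_inter.2 ⟨hu, hw⟩) hu'
  have hu : Enters tl hd (X ∪ Y) a → Enters tl hd X a ∨ Enters tl hd Y a := by
    rintro ⟨h1, h2⟩
    exact (mem_union.1 h1).imp (fun h => ⟨h, fun u hu => h2 u (mem_union_left _ hu)⟩)
      (fun h => ⟨h, fun u hu => h2 u (mem_union_right _ hu)⟩)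
  have hb : Enters tl hd (X ∩ Y) a → Enters tl hd (X ∪ Y) a →
      Enters tl hd X a ∧ Enters tl hd Y a := by
    rintro ⟨h1, -⟩ ⟨-, h2⟩
    rw [mem_inter] at h1
    exact ⟨⟨h1.1, fun u hu => h2 u (mem_union_left _ hu)⟩,
      ⟨h1.2, fun u hu => h2 u (mem_union_right _ hu)⟩⟩
  split_ifs <;> first | omega | (exfalso; tauto)

theorem enterCard_le_erase_add_one [DecidableEq A] (E : Finset A) (X : Finset V) (a : A) :
    enterCard tl hd E X ≤ enterCard tl hd (E.erase a) X + 1 := by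
  classical
  rw [enterCard, enterCard, filter_erase]
  exact Nat.sub_le_iff_le_add.1 pred_card_le_card_erase

theorem enterCard_erase_of_not_enters [DecidableEq A] (E : Finset A) {X : Finset V} {a : A}
    (h : ¬ Enters tl hd X a) : enterCard tl hd (E.erase a) X = enterCard tl hd E X := by
  classical
  rw [enterCard, enterCard, filter_erase, erase_eq_of_notMem (by simp [h])]

variable [DecidableEq V] [DecidableEq A]

theorem IsRootedArb.insert {T : Finset A} (hT : IsRootedArb tl hd T) {a : A}
    (ha : hd a ∉ T.image hd) (hta : ∀ u, tl a = some u → u ∈ T.image hd) :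
    IsRootedArb tl hd (insert a T) where
  inj := by
    have haT : a ∉ T := fun h => ha (mem_image_of_mem hd h)
    rw [coe_insert, Set.injOn_insert (by simpa using haT)]
    exact ⟨hT.inj, by simpa using ha⟩
  tail_mem b hb u hu := by
    rw [image_insert, mem_insert]
    rcases mem_insert.1 hb with rfl | hb
    · exact .inr (hta u hu)
    · exact .inr (hT.tail_mem b hb u hu)
  rank := by
    obtain ⟨f, hf⟩ := hT.rank
    have key : ∀ u ∈ T.image hd, u ≠ hd a := fun u hu h => ha (h ▸ hu)
    refine ⟨Function.update f (hd a) ((T.image hd).sup f + 1), fun b hb u hu => ?_⟩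
    rcases mem_insert.1 hb with rfl | hb
    · rw [Function.update_of_ne (key u (hta u hu)), Function.update_self]
      exact Nat.lt_succ_of_le (le_sup (f := f) (hta u hu))
    · rw [Function.update_of_ne (key u (hT.tail_mem b hb u hu)),
        Function.update_of_ne (key _ (mem_image_of_mem hd hb))]
      exact hf b hb u hu

variable [Fintype V]

/-- The augmentation step in Lovász's proof of Edmonds' theorem. -/
theorem exists_arc_augmenting {E T : Finset A} {k : ℕ}
    (hE : ∀ X : Finset V, X.Nonempty → k + 1 ≤ enterCard tl hd E X)
    (hET : ∀ X : Finset V, X.Nonempty → k ≤ enterCard tl hd (E \ T) X)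
    (hS : T.image hd ≠ univ) :
    ∃ a ∈ E \ T, hd a ∉ T.image hd ∧ (∀ u, tl a = some u → u ∈ T.image hd) ∧
      ∀ Y, Enters tl hd Y a → enterCard tl hd (E \ T) Y ≠ k := by
  classical
  set S := T.image hd
  have hout : ∀ Z : Finset V, Disjoint Z S → Z.Nonempty → k + 1 ≤ enterCard tl hd (E \ T) Z := by
    intro Z hZ hne
    refine (hE Z hne).trans (card_le_card fun a ha => ?_)
    rw [mem_filter] at ha ⊢
    exact ⟨mem_sdiff.2 ⟨ha.1, fun h =>
      disjoint_left.1 hZ ha.2.1 (mem_image_of_mem hd h)⟩, ha.2⟩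
  by_cases hc : ∃ X : Finset V, (X \ S).Nonempty ∧ enterCard tl hd (E \ T) X = k
  · obtain ⟨X, hX, hmin⟩ := exists_min_image
      (univ.filter fun X : Finset V => (X \ S).Nonempty ∧ enterCard tl hd (E \ T) X = k)
      card (by simpa [Finset.Nonempty] using hc)
    simp only [mem_filter, mem_univ, true_and] at hX hmin
    have hlt : enterCard tl hd (E \ T) X < enterCard tl hd (E \ T) (X \ S) := by
      have := hout (X \ S) sdiff_disjoint hX.1
      omega
    obtain ⟨a, ha, haX⟩ := exists_mem_notMem_of_card_lt_card hlt
    rw [mem_filter] at ha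
    obtain ⟨haE, haZ⟩ := ha
    have hhd := mem_sdiff.1 haZ.1
    have hu : ∃ u ∈ X, tl a = some u := by
      by_contra! h
      exact haX (mem_filter.2 ⟨haE, hhd.1, h⟩)
    obtain ⟨u, huX, hu⟩ := hu
    refine ⟨a, haE, hhd.2, fun w hw => ?_, fun Y hY hk => ?_⟩
    · by_contra hwS
      rw [hu, Option.some.injEq] at hw
      subst hw
      exact haZ.2 u (mem_sdiff.2 ⟨huX, hwS⟩) hu
    · have hsub := enterCard_submodular (tl := tl) (hd := hd) (E \ T) X Y
      have hi := hET (X ∩ Y) ⟨hd a, mem_inter.2 ⟨hhd.1, hY.1⟩⟩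
      have hun := hET (X ∪ Y) ⟨hd a, mem_union_right _ hY.1⟩
      have hle := hmin (X ∩ Y) ⟨⟨hd a, mem_sdiff.2 ⟨mem_inter.2 ⟨hhd.1, hY.1⟩, hhd.2⟩⟩, by omega⟩
      have heq := eq_of_subset_of_card_le inter_subset_left hle
      exact hY.2 u (mem_inter.1 (heq ▸ huX)).2 hu
  · push Not at hc
    have hpos := hout Sᶜ disjoint_compl_left (by
      rwa [nonempty_iff_ne_empty, Ne, compl_eq_empty_iff])
    obtain ⟨a, ha⟩ := card_pos.1 (Nat.lt_of_lt_of_le k.succ_pos hpos)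
    rw [mem_filter] at ha
    have hhd := mem_compl.1 ha.2.1
    refine ⟨a, ha.1, hhd, fun u hu => ?_, fun Y hY => hc Y ⟨hd a, mem_sdiff.2 ⟨hY.1, hhd⟩⟩⟩
    by_contra huS
    exact ha.2.2 u (mem_compl.2 huS) hu

theorem exists_spanning_arb {E : Finset A} {k : ℕ}
    (hE : ∀ X : Finset V, X.Nonempty → k + 1 ≤ enterCard tl hd E X) :
    ∃ T ⊆ E, IsRootedArb tl hd T ∧ T.image hd = univ ∧
      ∀ X : Finset V, X.Nonempty → k ≤ enterCard tl hd (E \ T) X := by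
  classical
  obtain ⟨T, hT, hmax⟩ := exists_max_image
    (E.powerset.filter fun T => IsRootedArb tl hd T ∧
      ∀ X : Finset V, X.Nonempty → k ≤ enterCard tl hd (E \ T) X) card
    ⟨∅, by
      simp only [mem_filter, empty_mem_powerset, true_and, sdiff_empty]
      exact ⟨⟨by simp, by simp, ⟨0, by simp⟩⟩, fun X hX => (Nat.le_succ k).trans (hE X hX)⟩⟩
  simp only [mem_filter, mem_powerset] at hT hmax
  obtain ⟨hTE, hTarb, hTk⟩ := hT
  refine ⟨T, hTE, hTarb, ?_, hTk⟩
  by_contra hS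
  obtain ⟨a, ha, hhd, hta, hY⟩ := exists_arc_augmenting hE hTk hS
  have haE := mem_sdiff.1 ha
  have hle := hmax (insert a T) ⟨insert_subset haE.1 hTE, hTarb.insert hhd hta, fun X hX => by
    rw [sdiff_insert]
    by_cases hent : Enters tl hd X a
    · have h1 := hY X hent
      have h2 := hTk X hX
      have h3 := enterCard_le_erase_add_one (tl := tl) (hd := hd) (E \ T) X a
      omega
    · rw [enterCard_erase_of_not_enters _ hent]
      exact hTk X hX⟩
  rw [card_insert_of_notMem haE.2] at hle
  omega

/-- **Edmonds' disjoint arborescences theorem.** -/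
theorem exists_disjoint_spanning_arbs (k : ℕ) (E : Finset A)
    (hE : ∀ X : Finset V, X.Nonempty → k ≤ enterCard tl hd E X) :
    ∃ T : Fin k → Finset A, (∀ i, T i ⊆ E) ∧ (∀ i, IsRootedArb tl hd (T i)) ∧
      (∀ i, (T i).image hd = univ) ∧ ∀ i j, i ≠ j → Disjoint (T i) (T j) := by
  induction k generalizing E with
  | zero => exact ⟨fun _ => ∅, nofun, nofun, nofun, nofun⟩
  | succ k ih =>
    obtain ⟨T₀, hT₀, harb, hspan, hk⟩ := exists_spanning_arb hE
    obtain ⟨T, hTE, hTarb, hTspan, hdisj⟩ := ih (E \ T₀) hk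
    have h0 : ∀ i, Disjoint T₀ (T i) := fun i =>
      disjoint_of_subset_right (hTE i) disjoint_sdiff
    refine ⟨Fin.cons T₀ T, Fin.cases hT₀ fun i => (hTE i).trans sdiff_subset,
      Fin.cases harb hTarb, Fin.cases hspan hTspan, ?_⟩
    refine Fin.cases (Fin.cases (fun h => (h rfl).elim) fun j _ => h0 j) fun i =>
      Fin.cases (fun _ => (h0 i).symm) fun j hij => hdisj i j fun h => hij (h ▸ rfl)

end RootedArborescences

section Decomposition

variable {V A : Type} [DecidableEq V] {tl hd : A → V}

theorem IsBranching.exists_tail_notMem {B E : Finset A} (hB : IsBranching tl hd B) (hE : E ⊆ B)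
    (hne : E.Nonempty) : ∃ a ∈ E, tl a ∉ E.image hd := by
  by_contra! h
  have hwf : WellFounded fun u v : E.image hd => Relation.TransGen (DStep tl hd B) u.1 v.1 := by
    have : IsTrans (E.image hd) fun u v => Relation.TransGen (DStep tl hd B) u.1 v.1 :=
      ⟨fun _ _ _ => Relation.TransGen.trans⟩
    have : Std.Irrefl fun u v : E.image hd => Relation.TransGen (DStep tl hd B) u.1 v.1 :=
      ⟨fun v => hB.2 v⟩
    exact Finite.wellFounded_of_trans_of_irrefl _
  obtain ⟨a₀, ha₀⟩ := hne
  obtain ⟨⟨v, hv⟩, -, hmin⟩ := hwf.has_min Set.univ ⟨⟨hd a₀, mem_image_of_mem hd ha₀⟩, trivial⟩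
  obtain ⟨a, ha, rfl⟩ := mem_image.1 hv
  exact hmin ⟨tl a, h a ha⟩ trivial (.single ⟨a, hE ha, rfl, rfl⟩)

theorem IsBranching.isForest {B : Finset A} (hB : IsBranching tl hd B) : IsForest tl hd B := by
  intro E hE hne
  obtain ⟨a, ha, hta⟩ := hB.exists_tail_notMem hE hne
  have hcard : (E.image hd).card = E.card :=
    card_image_of_injOn fun a ha b hb h => hB.1 a (hE ha) b (hE hb) h
  rw [← hcard]
  exact card_lt_card (ssubset_iff_of_subset subset_union_right |>.2
    ⟨tl a, mem_union_left _ (mem_image_of_mem tl ha), hta⟩)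

theorem card_filter_head_le_of_branchings [Fintype A] [DecidableEq A] {k : ℕ}
    {B : Fin k → Finset A} (hB : ∀ i, IsBranching tl hd (B i)) (hU : univ.biUnion B = univ)
    (v : V) : (univ.filter fun a => hd a = v).card ≤ k := by
  rw [← hU, filter_biUnion]
  refine card_biUnion_le.trans ?_
  refine (sum_le_card_nsmul univ _ 1 fun i _ => card_le_one.2 fun a ha b hb => ?_).trans (by simp)
  rw [mem_filter] at ha hb
  exact (hB i).1 a ha.1 b hb.1 (ha.2.trans hb.2.symm)

theorem IsForest.card_filter_induced_le {F : Finset A} (hF : IsForest tl hd F)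
    (X : Finset V) : (F.filter fun a => hd a ∈ X ∧ tl a ∈ X).card ≤ X.card - 1 := by
  rcases (F.filter fun a => hd a ∈ X ∧ tl a ∈ X).eq_empty_or_nonempty with h | h
  · simp [h]
  · refine Nat.le_sub_one_of_lt ((hF _ (filter_subset _ _) h).trans_le (card_le_card ?_))
    refine union_subset ?_ ?_ <;> refine image_subset_iff.2 fun a ha => ?_
    · exact (mem_filter.1 ha).2.2
    · exact (mem_filter.1 ha).2.1

variable [Fintype A]

theorem card_induced_le_of_forests [DecidableEq A] {k : ℕ} {F : Fin k → Finset A}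
    (hF : ∀ i, IsForest tl hd (F i)) (hU : univ.biUnion F = univ) (X : Finset V) :
    (univ.filter fun a => hd a ∈ X ∧ tl a ∈ X).card ≤ k * (X.card - 1) := by
  rw [← hU, filter_biUnion]
  refine card_biUnion_le.trans ?_
  refine (sum_le_card_nsmul univ _ _ fun i _ => (hF i).card_filter_induced_le X).trans (by simp)

/-- Tails in the digraph obtained by adding `m v` arcs from an extra root to each vertex `v`. -/
def rootedTail (tl : A → V) (m : V → ℕ) : A ⊕ (Σ v, Fin (m v)) → Option V :=
  Sum.elim (fun a => some (tl a)) fun _ => none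

/-- Heads in the digraph obtained by adding `m v` arcs from an extra root to each vertex `v`. -/
def rootedHead (hd : A → V) (m : V → ℕ) : A ⊕ (Σ v, Fin (m v)) → V :=
  Sum.elim hd Sigma.fst

theorem IsRootedArb.isBranching [DecidableEq A] {m : V → ℕ} {T : Finset (A ⊕ (Σ v, Fin (m v)))}
    (hT : IsRootedArb (rootedTail tl m) (rootedHead hd m) T) :
    IsBranching tl hd (univ.filter fun a => Sum.inl a ∈ T) := by
  constructor
  · intro a ha b hb hab
    simp only [mem_filter, mem_univ, true_and] at ha hb
    exact Sum.inl_injective (hT.inj ha hb hab)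
  · obtain ⟨f, hf⟩ := hT.rank
    have hlt : ∀ u v, Relation.TransGen
        (DStep tl hd (univ.filter fun a => Sum.inl a ∈ T)) u v → f u < f v := by
      intro u v h
      refine Relation.TransGen.trans_induction_on (motive := fun {u v} _ => f u < f v) h ?_
        fun _ _ => lt_trans
      rintro u v ⟨a, ha, rfl, rfl⟩
      exact hf _ (mem_filter.1 ha).2 _ rfl
    exact fun v h => lt_irrefl _ (hlt v v h)

variable [Fintype V]

theorem le_enterCard_rooted {k : ℕ} (hdeg : ∀ v, (univ.filter fun a => hd a = v).card ≤ k)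
    {X : Finset V} (hX : X.Nonempty)
    (hind : (univ.filter fun a => hd a ∈ X ∧ tl a ∈ X).card ≤ k * (X.card - 1)) :
    k ≤ enterCard (rootedTail tl fun v => k - (univ.filter fun a => hd a = v).card)
      (rootedHead hd fun v => k - (univ.filter fun a => hd a = v).card) univ X := by
  classical
  set m : V → ℕ := fun v => k - (univ.filter fun a => hd a = v).card
  have hsub : (univ.filter fun a => hd a ∈ X ∧ tl a ∉ X).disjSum
      (X.sigma fun v => (univ : Finset (Fin (m v)))) ⊆
      univ.filter (Enters (rootedTail tl m) (rootedHead hd m) X) := by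
    rintro (a | ⟨v, i⟩) h
    · simp only [inl_mem_disjSum, mem_filter, mem_univ, true_and] at h
      refine mem_filter.2 ⟨mem_univ _, h.1, fun u hu hau => h.2 ?_⟩
      rwa [Option.some.inj hau]
    · simp only [inr_mem_disjSum, mem_sigma, mem_univ, and_true] at h
      exact mem_filter.2 ⟨mem_univ _, h, fun u _ => nofun⟩
  have hle := card_le_card hsub
  rw [card_disjSum, card_sigma] at hle
  simp only [card_univ, Fintype.card_fin] at hle
  have hsum : ∑ v ∈ X, m v + ∑ v ∈ X, (univ.filter fun a => hd a = v).card = X.card * k := by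
    rw [← sum_add_distrib, ← smul_eq_mul, ← sum_const]
    exact sum_congr rfl fun v _ => Nat.sub_add_cancel (hdeg v)
  have hfib : (univ.filter fun a => hd a ∈ X).card =
      ∑ v ∈ X, (univ.filter fun a => hd a = v).card := by
    rw [card_eq_sum_card_fiberwise (f := hd) (t := X) fun a ha => mem_coe.2 (mem_filter.1 ha).2]
    refine sum_congr rfl fun v hv => ?_
    rw [filter_filter]
    congr 1
    ext a
    simp only [mem_filter, mem_univ, true_and, and_iff_right_iff_imp]
    exact fun h => h ▸ hv
  have hsplit := card_filter_add_card_filter_not (s := univ.filter fun a => hd a ∈ X)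
    (fun a => tl a ∈ X)
  rw [filter_filter, filter_filter] at hsplit
  have hmul : X.card * k = k * (X.card - 1) + k := by
    obtain ⟨n, hn⟩ := Nat.exists_eq_add_of_lt (card_pos.2 hX)
    rw [hn]
    simp only [Nat.zero_add, Nat.add_sub_cancel]
    ring
  change k ≤ (univ.filter (Enters (rootedTail tl m) (rootedHead hd m) X)).card
  omega

theorem card_rooted_arcs {k : ℕ} (hdeg : ∀ v, (univ.filter fun a => hd a = v).card ≤ k) :
    Fintype.card (A ⊕ (Σ v, Fin (k - (univ.filter fun a => hd a = v).card))) =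
      k * Fintype.card V := by
  rw [Fintype.card_sum, Fintype.card_sigma, ← card_univ (α := A),
    card_eq_sum_card_fiberwise (f := hd) (t := univ) fun a _ => mem_coe.2 (mem_univ _),
    ← sum_add_distrib, mul_comm, ← smul_eq_mul, ← card_univ, ← sum_const]
  refine sum_congr rfl fun v _ => ?_
  rw [Fintype.card_fin]
  exact Nat.add_sub_cancel' (hdeg v)

end Decomposition

/-- **Theorem (Frank).**  A digraph `D` can be decomposed into `k` branchings
iff its maximum in-degree is at most `k` and its underlying undirected graph
can be decomposed into `k` forests. -/
theorem decomposition_into_branchings_iff_forests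
    {V A : Type} [Fintype V] [DecidableEq V] [Fintype A] [DecidableEq A]
    (tl hd : A → V) (hloop : ∀ a, tl a ≠ hd a) (k : ℕ) :
    (∃ B : Fin k → Finset A,
        (∀ i, IsBranching tl hd (B i)) ∧
        (∀ i j, i ≠ j → Disjoint (B i) (B j)) ∧
        Finset.univ.biUnion B = (Finset.univ : Finset A)) ↔
    ((∀ v : V, (Finset.univ.filter fun a : A => hd a = v).card ≤ k) ∧
      (∃ Es : Fin k → Finset A,
        (∀ i, IsForest tl hd (Es i)) ∧
        (∀ i j, i ≠ j → Disjoint (Es i) (Es j)) ∧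
        Finset.univ.biUnion Es = (Finset.univ : Finset A))) := by
  constructor
  · rintro ⟨B, hB, hdisj, hU⟩
    exact ⟨card_filter_head_le_of_branchings hB hU, B, fun i => (hB i).isForest, hdisj, hU⟩
  · rintro ⟨hdeg, F, hF, -, hU⟩
    obtain ⟨T, -, harb, hspan, hdisj⟩ := exists_disjoint_spanning_arbs k univ fun X hX =>
      le_enterCard_rooted hdeg hX (card_induced_le_of_forests hF hU X)
    have hT : univ.biUnion T = univ := by
      rw [← card_eq_iff_eq_univ, card_biUnion fun i _ j _ => hdisj i j, card_rooted_arcs hdeg]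
      have hcard : ∀ i, (T i).card = Fintype.card V := fun i => by
        rw [← card_univ, ← hspan i, card_image_of_injOn (harb i).inj]
      simp [hcard]
    refine ⟨fun i => univ.filter fun a => Sum.inl a ∈ T i, fun i => (harb i).isBranching,
      fun i j hij => ?_, ?_⟩
    · refine disjoint_left.2 fun a ha hb => ?_
      exact disjoint_left.1 (hdisj i j hij) (mem_filter.1 ha).2 (mem_filter.1 hb).2
    · refine eq_univ_of_forall fun a => ?_
      obtain ⟨i, -, hi⟩ := mem_biUnion.1 (hT ▸ mem_univ (Sum.inl a))
      exact mem_biUnion.2 ⟨i, mem_univ _, mem_filter.2 ⟨mem_univ _, hi⟩⟩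
end
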